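/- arXiv:1411.3887 — 5 statements merged into one kernel-verified Lean document; each statement's English description precedes it below -/
import Mathlib

section
/- There is a constant c > 0 such that for all sufficiently large integers d there is a number of machines m with the following property: for every deterministic online algorithm A for vector scheduling on m identical machines with d dimensions, there exists a finite sequence σ of jobs such that some assignment of the jobs of σ to the machines has load at most 1 on every machine in every dimension, yet the assignment produced by A on σ has some machine whose load in some dimension is at least c · (log d)/(log log d). -/
/-- Identical machines: load of machine `i` in dimension `k` when the jobs of `σ`
(each a `d`-dimensional vector of nonnegative loads, identical on all machines)
are assigned to the `m` machines via the assignment `f`. -/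
def idLoad {d m : ℕ} (σ : List (Fin d → NNReal)) (f : Fin σ.length → Fin m)
    (i : Fin m) (k : Fin d) : NNReal :=
  ∑ j : Fin σ.length, if f j = i then σ.get j k else 0

/-- The assignment produced by a deterministic online algorithm `A` on the job
sequence `σ`: the `j`-th job is assigned to the machine output by `A` on the
prefix of `σ` ending with that job. -/
def idOnline {d m : ℕ} (A : List (Fin d → NNReal) → Fin m)
    (σ : List (Fin d → NNReal)) : Fin σ.length → Fin m :=
  fun j => A (σ.take (j.1 + 1))

open Finset

/-- Job number `t` loads dimension `S` (a set of job indices), when `used` are the true machines of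
the earlier jobs loading `S`: the index `t` lies in `S`, and neither of the two candidate machines
of the job is in `used`. -/
def loadsAfter {m : ℕ} (P : ℕ → Fin m × Fin m) (S : Finset ℕ) (used : Finset (Fin m)) (t : ℕ) :
    Prop :=
  t ∈ S ∧ (P t).1 ∉ used ∧ (P t).2 ∉ used

instance {m : ℕ} (P : ℕ → Fin m × Fin m) (S : Finset ℕ) (used : Finset (Fin m)) (t : ℕ) :
    Decidable (loadsAfter P S used t) :=
  inferInstanceAs (Decidable (_ ∧ _))

/-- The true machines of the jobs loading dimension `S`, after a history of true machines of all
jobs, most recent first. -/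
def usedMachines {m : ℕ} (P : ℕ → Fin m × Fin m) (S : Finset ℕ) : List (Fin m) → Finset (Fin m)
  | [] => ∅
  | c :: h =>
    if loadsAfter P S (usedMachines P S h) h.length then insert c (usedMachines P S h)
    else usedMachines P S h

/-- The next job after the history `h` of true machines, where `D` names the dimensions. -/
def adversaryJob {d m : ℕ} (P : ℕ → Fin m × Fin m) (D : Fin d → Finset ℕ) (h : List (Fin m)) :
    Fin d → NNReal :=
  fun k => if loadsAfter P (D k) (usedMachines P (D k) h) h.length then 1 else 0

/-- The job sequence leading to the history `h` of true machines. -/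
def adversaryJobs {d m : ℕ} (P : ℕ → Fin m × Fin m) (D : Fin d → Finset ℕ) :
    List (Fin m) → List (Fin d → NNReal)
  | [] => []
  | _ :: h => adversaryJobs P D h ++ [adversaryJob P D h]

/-- The number of jobs loading dimension `S` on machine `b`, when the job following the history `h`
is put on machine `B h`. -/
def responseLoad {m : ℕ} (P : ℕ → Fin m × Fin m) (B : List (Fin m) → Fin m) (S : Finset ℕ)
    (b : Fin m) : List (Fin m) → ℕ
  | [] => 0
  | _ :: h => responseLoad P B S b h +
      if B h = b ∧ loadsAfter P S (usedMachines P S h) h.length then 1 else 0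

/-- Every true machine in the history is one of the two candidates of its job. -/
def AdmissibleHistory {m : ℕ} (P : ℕ → Fin m × Fin m) : List (Fin m) → Prop
  | [] => True
  | c :: h => (c = (P h.length).1 ∨ c = (P h.length).2) ∧ AdmissibleHistory P h

lemma idLoad_append_singleton {d m : ℕ} (σ : List (Fin d → NNReal)) (v : Fin d → NNReal)
    (f : Fin (σ ++ [v]).length → Fin m) (i : Fin m) (k : Fin d) :
    idLoad (σ ++ [v]) f i k =
      idLoad σ (fun j => f ⟨j, by grind⟩) i k +
        if f ⟨σ.length, by simp⟩ = i then v k else 0 := by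
  have hl : σ.length + 1 = (σ ++ [v]).length := by simp
  unfold idLoad
  rw [← (finCongr hl).sum_comp, Fin.sum_univ_castSucc]
  congr 1
  · refine Finset.sum_congr rfl fun j _ => ?_
    simp [finCongr]
    rfl
  · simp [finCongr]
    rfl

lemma idOnline_append_singleton {d m : ℕ} (A : List (Fin d → NNReal) → Fin m)
    (σ : List (Fin d → NNReal)) (v : Fin d → NNReal) :
    (fun j : Fin σ.length => idOnline A (σ ++ [v]) ⟨j, by grind⟩) = idOnline A σ := by
  funext j
  have : σ.take (j.1 + 1) = (σ ++ [v]).take (j.1 + 1) :=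
    (List.take_append_of_le_length j.2).symm
  simp [idOnline, this]

lemma idLoad_idOnline_adversaryJobs {d m : ℕ} (P : ℕ → Fin m × Fin m) (D : Fin d → Finset ℕ)
    (A : List (Fin d → NNReal) → Fin m) (b : Fin m) (k : Fin d) (h : List (Fin m)) :
    idLoad (adversaryJobs P D h) (idOnline A (adversaryJobs P D h)) b k =
      responseLoad P (fun h => A (adversaryJobs P D h ++ [adversaryJob P D h])) (D k) b h := by
  induction h with
  | nil => simp [idLoad, adversaryJobs, responseLoad]
  | cons c h ih =>
    simp only [adversaryJobs]
    rw [idLoad_append_singleton, idOnline_append_singleton, ih]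
    simp only [responseLoad, Nat.cast_add]
    congr 1
    have : (adversaryJobs P D h ++ [adversaryJob P D h]).take ((adversaryJobs P D h).length + 1) =
        adversaryJobs P D h ++ [adversaryJob P D h] := List.take_of_length_le (by simp)
    simp only [idOnline, this, adversaryJob, ite_and, Nat.cast_ite, Nat.cast_one, Nat.cast_zero]

lemma exists_idLoad_adversaryJobs {d m : ℕ} (P : ℕ → Fin m × Fin m) (D : Fin d → Finset ℕ)
    (h : List (Fin m)) (hh : AdmissibleHistory P h) :
    ∃ f : Fin (adversaryJobs P D h).length → Fin m, ∀ i k,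
      idLoad (adversaryJobs P D h) f i k = if i ∈ usedMachines P (D k) h then 1 else 0 := by
  induction h with
  | nil => exact ⟨fun j => absurd j.2 (by simp [adversaryJobs]), by
      simp [idLoad, adversaryJobs, usedMachines]⟩
  | cons c h ih =>
    obtain ⟨f, hf⟩ := ih hh.2
    refine ⟨fun j => if hj : j.1 < (adversaryJobs P D h).length then f ⟨j, hj⟩ else c,
      fun i k => ?_⟩
    simp only [adversaryJobs]
    rw [idLoad_append_singleton]
    simp only [Fin.is_lt, dite_true, Fin.eta, lt_irrefl, dite_false, hf, usedMachines, adversaryJob]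
    by_cases hl : loadsAfter P (D k) (usedMachines P (D k) h) h.length
    · have hc : c ∉ usedMachines P (D k) h := by
        rcases hh.1 with rfl | rfl
        exacts [hl.2.1, hl.2.2]
      by_cases hci : c = i
      · subst hci; simp [hl, hc]
      · simp [hl, hci, Ne.symm hci]
    · simp [hl]

lemma loadsAfter_insert {m : ℕ} (P : ℕ → Fin m × Fin m) (S : Finset ℕ) (used : Finset (Fin m))
    {s t : ℕ} (hst : s < t) : loadsAfter P (insert t S) used s ↔ loadsAfter P S used s := by
  simp [loadsAfter, hst.ne]

lemma usedMachines_insert {m : ℕ} (P : ℕ → Fin m × Fin m) (S : Finset ℕ) (t : ℕ)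
    (h : List (Fin m)) (ht : h.length ≤ t) :
    usedMachines P (insert t S) h = usedMachines P S h := by
  induction h with
  | nil => rfl
  | cons c h ih =>
    have hlt : h.length < t := ht
    simp [usedMachines, loadsAfter_insert P S _ hlt, ih hlt.le]

lemma responseLoad_insert {m : ℕ} (P : ℕ → Fin m × Fin m) (B : List (Fin m) → Fin m)
    (S : Finset ℕ) (b : Fin m) (t : ℕ) (h : List (Fin m)) (ht : h.length ≤ t) :
    responseLoad P B (insert t S) b h = responseLoad P B S b h := by
  induction h with
  | nil => rfl
  | cons c h ih =>
    have hlt : h.length < t := ht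
    simp [responseLoad, loadsAfter_insert P S _ hlt, ih hlt.le, usedMachines_insert P S t h hlt.le]

/-- On each machine `b` two sets of jobs `T b true` and `T b false`, each of which fully loads its
own dimension, such that every other job has its two candidates among the true machines of
these jobs, for some `b`. -/
structure IsCliqueFamily {m : ℕ} (P : ℕ → Fin m × Fin m) (B : List (Fin m) → Fin m)
    (h : List (Fin m)) (T : Fin m → Bool → Finset ℕ) : Prop where
  lt_length : ∀ b i, ∀ s ∈ T b i, s < h.length
  load_eq : ∀ b i, responseLoad P B (T b i) b h = #(T b i)
  card_used_le : ∀ b i, #(usedMachines P (T b i) h) ≤ #(T b i)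
  disjoint : ∀ b, Disjoint (usedMachines P (T b true) h) (usedMachines P (T b false) h)
  covers : ∀ s < h.length, ∃ b, (∃ i, s ∈ T b i) ∨
    ((∃ i, (P s).1 ∈ usedMachines P (T b i) h) ∧ ∃ i, (P s).2 ∈ usedMachines P (T b i) h)

lemma usedMachines_cons_of_notMem {m : ℕ} (P : ℕ → Fin m × Fin m) (S : Finset ℕ) (c : Fin m)
    (h : List (Fin m)) (hS : h.length ∉ S) :
    usedMachines P S (c :: h) = usedMachines P S h := by
  simp [usedMachines, loadsAfter, hS]

lemma responseLoad_cons_of_notMem {m : ℕ} (P : ℕ → Fin m × Fin m) (B : List (Fin m) → Fin m)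
    (S : Finset ℕ) (b c : Fin m) (h : List (Fin m)) (hS : h.length ∉ S) :
    responseLoad P B S b (c :: h) = responseLoad P B S b h := by
  simp [responseLoad, loadsAfter, hS]

namespace IsCliqueFamily

variable {m : ℕ} {P : ℕ → Fin m × Fin m} {B : List (Fin m) → Fin m} {h : List (Fin m)}
  {T : Fin m → Bool → Finset ℕ}

lemma length_notMem (hT : IsCliqueFamily P B h T) (b : Fin m) (i : Bool) : h.length ∉ T b i :=
  fun hs => (hT.lt_length b i _ hs).false

lemma cons_of_mem (hT : IsCliqueFamily P B h T) (c : Fin m)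
    (h₁ : ∃ i, (P h.length).1 ∈ usedMachines P (T (B h) i) h)
    (h₂ : ∃ i, (P h.length).2 ∈ usedMachines P (T (B h) i) h) :
    IsCliqueFamily P B (c :: h) T := by
  have hu b i := usedMachines_cons_of_notMem P (T b i) c h (hT.length_notMem b i)
  refine ⟨fun b i s hs => (hT.lt_length b i s hs).trans (by simp), fun b i => ?_, fun b i => ?_,
    fun b => ?_, fun s hs => ?_⟩
  · rw [responseLoad_cons_of_notMem _ _ _ _ _ _ (hT.length_notMem b i), hT.load_eq]
  · rw [hu]; exact hT.card_used_le b i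
  · rw [hu, hu]; exact hT.disjoint b
  · simp only [hu]
    rcases Nat.lt_succ_iff_lt_or_eq.1 hs with hs | rfl
    · exact hT.covers s hs
    · exact ⟨B h, Or.inr ⟨h₁, h₂⟩⟩

lemma cons_of_notMem (hT : IsCliqueFamily P B h T) (c : Fin m) (i₀ : Bool)
    (hc : ∀ i, c ∉ usedMachines P (T (B h) i) h)
    (h₁ : (P h.length).1 ∉ usedMachines P (T (B h) i₀) h)
    (h₂ : (P h.length).2 ∉ usedMachines P (T (B h) i₀) h) :
    IsCliqueFamily P B (c :: h)
      (fun b i => if b = B h ∧ i = i₀ then insert h.length (T b i) else T b i) := by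
  have hn := hT.length_notMem
  have hu b i := usedMachines_cons_of_notMem P (T b i) c h (hn b i)
  have hu' : usedMachines P (insert h.length (T (B h) i₀)) (c :: h) =
      insert c (usedMachines P (T (B h) i₀) h) := by
    simp [usedMachines, loadsAfter, usedMachines_insert P (T (B h) i₀) _ h le_rfl, h₁, h₂]
  have hsub b i : usedMachines P (T b i) h ⊆ usedMachines P
      (if b = B h ∧ i = i₀ then insert h.length (T b i) else T b i) (c :: h) := by
    split_ifs with hbi
    · obtain ⟨rfl, rfl⟩ := hbi
      rw [hu']; exact subset_insert _ _
    · rw [hu]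
  refine ⟨fun b i s hs => ?_, fun b i => ?_, fun b i => ?_, fun b => ?_, fun s hs => ?_⟩
  · split_ifs at hs with hbi
    · rcases mem_insert.1 hs with rfl | hs
      · simp
      · exact (hT.lt_length b i s hs).trans (by simp)
    · exact (hT.lt_length b i s hs).trans (by simp)
  · split_ifs with hbi
    · obtain ⟨rfl, rfl⟩ := hbi
      rw [card_insert_of_notMem (hn _ _), ← hT.load_eq]
      simp [responseLoad, loadsAfter, usedMachines_insert P (T (B h) i) _ h le_rfl, h₁, h₂,
        responseLoad_insert P B (T (B h) i) (B h) _ h le_rfl]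
    · rw [responseLoad_cons_of_notMem _ _ _ _ _ _ (hn b i), hT.load_eq]
  · split_ifs with hbi
    · obtain ⟨rfl, rfl⟩ := hbi
      rw [card_insert_of_notMem (hn _ _), hu']
      exact (card_insert_le _ _).trans (Nat.succ_le_succ (hT.card_used_le _ _))
    · rw [hu]; exact hT.card_used_le b i
  · by_cases hb : b = B h
    · subst hb
      cases i₀
      · simpa [hu', hu] using ⟨hc true, hT.disjoint (B h)⟩
      · simpa [hu', hu] using ⟨hc false, hT.disjoint (B h)⟩
    · simpa [hb, hu] using hT.disjoint b
  · rcases Nat.lt_succ_iff_lt_or_eq.1 hs with hs | rfl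
    · obtain ⟨b, ⟨i, hi⟩ | ⟨⟨i, hi⟩, j, hj⟩⟩ := hT.covers s hs
      · refine ⟨b, Or.inl ⟨i, ?_⟩⟩
        split_ifs
        exacts [mem_insert_of_mem hi, hi]
      · exact ⟨b, Or.inr ⟨⟨i, hsub b i hi⟩, j, hsub b j hj⟩⟩
    · exact ⟨B h, Or.inl ⟨i₀, by simp⟩⟩

/-- The adversary can always answer so that the family persists, growing by at most one job. -/
lemma exists_cons (hT : IsCliqueFamily P B h T) :
    ∃ c T', (c = (P h.length).1 ∨ c = (P h.length).2) ∧ IsCliqueFamily P B (c :: h) T' ∧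
      ∀ b i, #(T' b i) ≤ #(T b i) + 1 := by
  by_cases hmem : (∃ i, (P h.length).1 ∈ usedMachines P (T (B h) i) h) ∧
      ∃ i, (P h.length).2 ∈ usedMachines P (T (B h) i) h
  · exact ⟨_, T, Or.inl rfl, hT.cons_of_mem _ hmem.1 hmem.2, fun b i => Nat.le_succ _⟩
  have hd := Finset.disjoint_left.1 (hT.disjoint (B h))
  obtain ⟨c, hcP, hc, i₀, h₁, h₂⟩ : ∃ c, (c = (P h.length).1 ∨ c = (P h.length).2) ∧
      (∀ i, c ∉ usedMachines P (T (B h) i) h) ∧ ∃ i₀,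
        (P h.length).1 ∉ usedMachines P (T (B h) i₀) h ∧
        (P h.length).2 ∉ usedMachines P (T (B h) i₀) h := by
    simp only [Bool.exists_bool, Bool.forall_bool] at hmem ⊢
    by_cases hx : (P h.length).1 ∈ usedMachines P (T (B h) false) h ∨
      (P h.length).1 ∈ usedMachines P (T (B h) true) h
    · have := @hd (P h.length).1
      exact ⟨_, Or.inr rfl, by tauto, by tauto⟩
    · have := @hd (P h.length).2
      exact ⟨_, Or.inl rfl, by tauto, by tauto⟩
  refine ⟨c, _, hcP, hT.cons_of_notMem c i₀ hc h₁ h₂, fun b i => ?_⟩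
  split_ifs
  exacts [card_insert_le _ _, Nat.le_succ _]

/-- If all sets of the family have fewer than `k` jobs, then there are fewer than `m * (4 * k ^ 2)`
jobs in total, provided that their candidate pairs are distinct. -/
lemma length_lt (hT : IsCliqueFamily P B h T) {k : ℕ} (hk : 0 < k) (hm : 0 < m)
    (hP : Set.InjOn P (range h.length)) (hcard : ∀ b i, #(T b i) < k) :
    h.length < m * (4 * k ^ 2) := by
  classical
  let H b := usedMachines P (T b true) h ∪ usedMachines P (T b false) h
  have hcover : range h.length ⊆ univ.biUnion fun b =>
      (T b true ∪ T b false) ∪ {s ∈ range h.length | P s ∈ H b ×ˢ H b} := by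
    intro s hs
    obtain ⟨b, hb⟩ := hT.covers s (mem_range.1 hs)
    refine mem_biUnion.2 ⟨b, mem_univ b, ?_⟩
    simp only [Bool.exists_bool] at hb
    simp only [H, mem_union, mem_filter, mem_product]
    tauto
  have hbound b : #((T b true ∪ T b false) ∪ {s ∈ range h.length | P s ∈ H b ×ˢ H b}) ≤
      2 * (k - 1) + (2 * (k - 1)) * (2 * (k - 1)) := by
    have h1 := hcard b true
    have h2 := hcard b false
    have hH : #(H b) ≤ 2 * (k - 1) := by
      have := card_union_le (usedMachines P (T b true) h) (usedMachines P (T b false) h)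
      have := hT.card_used_le b true
      have := hT.card_used_le b false
      simp only [H]
      omega
    have hfilter : #{s ∈ range h.length | P s ∈ H b ×ˢ H b} ≤ #(H b ×ˢ H b) :=
      card_le_card_of_injOn P (fun s hs => (mem_filter.1 hs).2)
        (hP.mono fun s hs => (mem_filter.1 hs).1)
    rw [card_product] at hfilter
    have := card_union_le (T b true) (T b false)
    refine (card_union_le _ _).trans (add_le_add (by omega) (hfilter.trans ?_))
    gcongr
  have hle := (card_le_card hcover).trans (card_biUnion_le_card_mul _ _ _ fun b _ => hbound b)
  rw [card_range, card_univ, Fintype.card_fin] at hle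
  refine hle.trans_lt (Nat.mul_lt_mul_of_pos_left ?_ hm)
  obtain ⟨k, rfl⟩ : ∃ l, k = l + 1 := ⟨k - 1, by omega⟩
  simp only [Nat.add_sub_cancel]
  nlinarith

end IsCliqueFamily

/-- Against any response `B` the adversary forces `k` jobs loading a common dimension onto one
machine, using at most `m * (4 * k ^ 2)` jobs. -/
lemma exists_responseLoad_eq {m k : ℕ} (hk : 0 < k) (hm : 0 < m) (P : ℕ → Fin m × Fin m)
    (hP : Set.InjOn P (range (m * (4 * k ^ 2)))) (B : List (Fin m) → Fin m) :
    ∃ h, AdmissibleHistory P h ∧ ∃ b, ∃ S ∈ powersetCard k (range (m * (4 * k ^ 2))),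
      responseLoad P B S b h = k := by
  by_contra! hcon
  have hfam : ∀ t ≤ m * (4 * k ^ 2), ∃ h T, h.length = t ∧ AdmissibleHistory P h ∧
      IsCliqueFamily P B h T ∧ ∀ b i, #(T b i) < k := by
    intro t
    induction t with
    | zero =>
      refine fun _ => ⟨[], fun _ _ => ∅, rfl, trivial, ⟨?_, ?_, ?_, ?_, ?_⟩, fun _ _ => by simpa⟩ <;>
        simp [responseLoad, usedMachines]
    | succ t ih =>
      intro ht
      obtain ⟨h, T, rfl, hh, hT, hlt⟩ := ih (by omega)
      obtain ⟨c, T', hc, hT', hle⟩ := hT.exists_cons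
      refine ⟨c :: h, T', rfl, ⟨hc, hh⟩, hT', fun b i => ?_⟩
      refine lt_of_le_of_ne ((hle b i).trans (hlt b i)) fun heq => ?_
      refine hcon (c :: h) ⟨hc, hh⟩ b (T' b i) (mem_powersetCard.2 ⟨fun s hs => ?_, heq⟩)
        ((hT'.load_eq b i).trans heq)
      exact mem_range.2 ((hT'.lt_length b i s hs).trans_le ht)
  obtain ⟨h, T, hlen, -, hT, hlt⟩ := hfam _ le_rfl
  exact (hT.length_lt hk hm (by rwa [hlen]) hlt).ne hlen

/-- If `(2k)^{4k} ≤ d`, then `4k²` machines admit a lower bound of `k`. -/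
lemma exists_idLoad_eq {d k : ℕ} (hk : 0 < k) (hd : (2 * k) ^ (4 * k) ≤ d)
    (A : List (Fin d → NNReal) → Fin (4 * k ^ 2)) :
    ∃ σ : List (Fin d → NNReal),
      (∃ f : Fin σ.length → Fin (4 * k ^ 2), ∀ i κ, idLoad σ f i κ ≤ 1) ∧
        ∃ i κ, idLoad σ (idOnline A σ) i κ = k := by
  have hm : 0 < 4 * k ^ 2 := by positivity
  obtain ⟨P, hP⟩ : ∃ P : ℕ → Fin (4 * k ^ 2) × Fin (4 * k ^ 2),
      Set.InjOn P (range (4 * k ^ 2 * (4 * k ^ 2))) := by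
    refine ⟨fun s => if hs : s < 4 * k ^ 2 * (4 * k ^ 2) then finProdFinEquiv.symm ⟨s, hs⟩
      else (⟨0, hm⟩, ⟨0, hm⟩), fun s hs t ht hst => ?_⟩
    have hs := mem_range.1 hs
    have ht := mem_range.1 ht
    simpa only [hs, ht, dite_true, EmbeddingLike.apply_eq_iff_eq, Fin.mk.injEq] using hst
  have hcard : Fintype.card (powersetCard k (range (4 * k ^ 2 * (4 * k ^ 2)))) ≤
      Fintype.card (Fin d) := by
    rw [Fintype.card_coe, card_powersetCard, card_range, Fintype.card_fin]
    refine (Nat.choose_le_pow _ _).trans (le_trans (le_of_eq ?_) hd)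
    rw [pow_mul]
    congr 1
    ring
  obtain ⟨e⟩ := Function.Embedding.nonempty_of_card_le hcard
  let D : Fin d → Finset ℕ := Function.extend e Subtype.val fun _ => ∅
  obtain ⟨h, hh, b, S, hS, hload⟩ := exists_responseLoad_eq hk hm P hP
    fun h => A (adversaryJobs P D h ++ [adversaryJob P D h])
  refine ⟨adversaryJobs P D h, ?_, b, e ⟨S, hS⟩, ?_⟩
  · obtain ⟨f, hf⟩ := exists_idLoad_adversaryJobs P D h hh
    refine ⟨f, fun i κ => ?_⟩
    rw [hf]
    split_ifs <;> simp
  · have hDS : D (e ⟨S, hS⟩) = S := e.injective.extend_apply _ _ _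
    rw [idLoad_idOnline_adversaryJobs, hDS, hload]

/-- The largest `k` with `4 k log (log d) ≤ log d` satisfies `(2k)^{4k} ≤ d`. -/
lemma exists_pow_le_of_log_log {d : ℕ} (h1 : 1 ≤ Real.log (Real.log d))
    (h4 : 4 * Real.log (Real.log d) ≤ Real.log d) :
    ∃ k : ℕ, 0 < k ∧ (2 * k) ^ (4 * k) ≤ d ∧
      1 / 8 * (Real.log d / Real.log (Real.log d)) ≤ k := by
  set L := Real.log d
  set M := Real.log L
  have hL : 4 ≤ L := by linarith
  have hd : 0 < d := by
    rcases Nat.eq_zero_or_pos d with rfl | hd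
    · simp [L] at hL; linarith
    · exact hd
  have hx : 1 ≤ L / (4 * M) := (one_le_div (by linarith)).2 h4
  have hk : 0 < ⌊L / (4 * M)⌋₊ := Nat.floor_pos.2 hx
  have hkle : (⌊L / (4 * M)⌋₊ : ℝ) ≤ L / (4 * M) := Nat.floor_le (by linarith)
  have hltk := Nat.lt_floor_add_one (L / (4 * M))
  have heq : L / M = 4 * (L / (4 * M)) := by field_simp
  generalize ⌊L / (4 * M)⌋₊ = k at *
  have hk1 : (1 : ℝ) ≤ k := by exact_mod_cast hk
  refine ⟨k, hk, ?_, by linarith⟩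
  have hkM : k * (4 * M) ≤ L := (le_div_iff₀ (by linarith)).1 hkle
  have hkL : 2 * (k : ℝ) ≤ L := by nlinarith
  have hlog : Real.log (2 * k) ≤ M := Real.log_le_log (by linarith) hkL
  have : Real.log ((2 * k : ℝ) ^ (4 * k)) ≤ Real.log d := by
    rw [Real.log_pow]
    push_cast
    nlinarith
  exact_mod_cast (Real.log_le_log_iff (by positivity) (by exact_mod_cast hd)).1 this

/-- Lower bound of `Ω(log d / log log d)` for online vector scheduling on
identical machines (VSMAX-I): there is `c > 0` such that for all sufficiently
large `d` there is a number of machines `m` so that every deterministic online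
algorithm `A` admits a job sequence `σ` for which some offline assignment has
load at most `1` on every machine in every dimension, while `A`'s assignment
has some machine with load at least `c · log d / log log d` in some dimension. -/
theorem vsmaxI_lowerBound :
    ∃ c : ℝ, 0 < c ∧ ∃ D : ℕ, ∀ d : ℕ, D ≤ d →
      ∃ m : ℕ, 0 < m ∧
        ∀ A : List (Fin d → NNReal) → Fin m,
          ∃ σ : List (Fin d → NNReal),
            (∃ f : Fin σ.length → Fin m, ∀ i k, idLoad σ f i k ≤ 1) ∧
            (∃ i k, c * (Real.log d / Real.log (Real.log d)) ≤
              (idLoad σ (idOnline A σ) i k : ℝ)) := by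
  have hlog : Filter.Tendsto (fun d : ℕ => Real.log d) Filter.atTop Filter.atTop :=
    Real.tendsto_log_atTop.comp tendsto_natCast_atTop_atTop
  have h1 := (Real.tendsto_log_atTop.comp hlog).eventually_ge_atTop 1
  have h4 := hlog.eventually (Real.isLittleO_log_id_atTop.bound (by norm_num : (0 : ℝ) < 1 / 4))
  obtain ⟨D, hD⟩ := Filter.eventually_atTop.1 (h1.and h4)
  refine ⟨1 / 8, by norm_num, D, fun d hd => ?_⟩
  obtain ⟨hd1, hd4⟩ := hD d hd
  have hd1 : 1 ≤ Real.log (Real.log d) := hd1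
  have hd4 : 4 * Real.log (Real.log d) ≤ Real.log d := by
    rw [Real.norm_of_nonneg (by linarith), id, Real.norm_of_nonneg (Real.log_natCast_nonneg d)]
      at hd4
    linarith
  obtain ⟨k, hk, hpow, hle⟩ := exists_pow_le_of_log_log hd1 hd4
  refine ⟨4 * k ^ 2, by positivity, fun A => ?_⟩
  obtain ⟨σ, hopt, i, κ, hload⟩ := exists_idLoad_eq hk hpow A
  exact ⟨σ, hopt, i, κ, by simpa [hload] using hle⟩
end

section
/- There is a constant c > 0 such that for every number of machines m ≥ 1 and every number of dimensions d ≥ 3, there exists a deterministic online algorithm A for vector scheduling on m identical machines with d dimensions with the following guarantee: for every finite job sequence σ, the assignment produced by A satisfies max_{k∈[d]} max_{i∈[m]} Λ_i^A(k) ≤ c · ((log d)/(log log d)) · OPT(σ), where OPT(σ) is the minimum over all assignments f of σ of max_{k∈[d]} max_{i∈[m]} Λ_i^f(k). -/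
/-- The load matrix after adding a job `p` to machine `i`. -/
def addJob {d m : ℕ} (L : Fin m → Fin d → ℝ) (i : Fin m) (p : Fin d → ℝ) :
    Fin m → Fin d → ℝ :=
  fun i' k => L i' k + if i = i' then p k else 0

lemma sum_addJob {d m : ℕ} (L : Fin m → Fin d → ℝ) (i : Fin m) (p : Fin d → ℝ) (k : Fin d) :
    ∑ i', addJob L i p i' k = ∑ i', L i' k + p k := by
  simp [addJob, Finset.sum_add_distrib]

/-- The exponential weight of machine `i` in dimension `k`, discounted so that it is a
supermartingale when jobs are assigned uniformly at random. -/
noncomputable def expWeight {d m : ℕ} (β : ℝ) (V : Fin m → Fin d → ℝ) (i : Fin m) (k : Fin d) :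
    ℝ :=
  β ^ V i k * Real.exp (-((β - 1) / m * ∑ i', V i' k))

lemma expWeight_nonneg {d m : ℕ} {β : ℝ} (hβ : 0 ≤ β) (V : Fin m → Fin d → ℝ) (i : Fin m)
    (k : Fin d) : 0 ≤ expWeight β V i k := by
  unfold expWeight; positivity

lemma expWeight_addJob {d m : ℕ} {β : ℝ} (hβ : 0 < β) (V : Fin m → Fin d → ℝ) (i : Fin m)
    (p : Fin d → ℝ) (i' : Fin m) (k : Fin d) :
    expWeight β (addJob V i p) i' k =
      expWeight β V i' k * Real.exp (-((β - 1) / m * p k)) *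
        (if i = i' then β ^ p k else 1) := by
  unfold expWeight
  rw [sum_addJob, mul_add, neg_add, Real.exp_add]
  by_cases h : i = i'
  · simp only [addJob, h, if_true, Real.rpow_add hβ]; ring
  · simp only [addJob, h, if_false, add_zero]; ring

lemma sum_expWeight_addJob_le {d m : ℕ} {β : ℝ} (hm : 1 ≤ m) (hβ : 1 < β)
    (V : Fin m → Fin d → ℝ) (p : Fin d → ℝ) (hp0 : ∀ k, 0 ≤ p k) (hp1 : ∀ k, p k ≤ 1)
    (i' : Fin m) (k : Fin d) :
    ∑ i, expWeight β (addJob V i p) i' k ≤ m * expWeight β V i' k := by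
  have hm0 : (0 : ℝ) < m := by exact_mod_cast hm
  simp only [expWeight_addJob (zero_lt_one.trans hβ)]
  rw [← Finset.mul_sum]
  have hsum : ∑ i : Fin m, (if i = i' then β ^ p k else 1) = m - 1 + β ^ p k := by
    have : ∀ i : Fin m, (if i = i' then β ^ p k else (1 : ℝ)) =
        1 + if i = i' then β ^ p k - 1 else 0 := by
      intro i; split_ifs <;> ring
    simp only [this, Finset.sum_add_distrib]
    simp
    ring
  rw [hsum]
  have hbern : β ^ p k ≤ 1 + p k * (β - 1) := by
    have := rpow_one_add_le_one_add_mul_self (s := β - 1) (by linarith) (hp0 k) (hp1 k)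
    simpa using this
  have hexp : (m : ℝ) - 1 + β ^ p k ≤ m * Real.exp ((β - 1) / m * p k) := by
    have h := Real.add_one_le_exp ((β - 1) / m * p k)
    have h2 : (m : ℝ) * ((β - 1) / m * p k + 1) = p k * (β - 1) + m := by field_simp
    nlinarith [mul_le_mul_of_nonneg_left h hm0.le]
  have hw := expWeight_nonneg (zero_lt_one.trans hβ).le V i' k
  calc _ ≤ expWeight β V i' k * Real.exp (-((β - 1) / m * p k)) *
        (m * Real.exp ((β - 1) / m * p k)) := by gcongr
    _ = m * expWeight β V i' k *
        (Real.exp (-((β - 1) / m * p k)) * Real.exp ((β - 1) / m * p k)) := by ring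
    _ = _ := by rw [← Real.exp_add]; simp

/-- A machine whose virtual load would exceed `B` has large exponential weight. -/
lemma one_le_sum_expWeight {d m : ℕ} {β B C : ℝ} (hm : 1 ≤ m) (hβ : 1 < β) (hC0 : 0 ≤ C)
    (hC : 1 ≤ C * (β ^ (B - 1) * Real.exp (-(β - 1)))) (V : Fin m → Fin d → ℝ)
    (hV : ∀ k, ∑ i, V i k ≤ m) (p : Fin d → ℝ) (hp1 : ∀ k, p k ≤ 1) (i : Fin m)
    (hi : ¬ ∀ k, V i k + p k ≤ B) :
    1 ≤ C * ∑ k, expWeight β V i k := by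
  have hm0 : (0 : ℝ) < m := by exact_mod_cast hm
  push Not at hi
  obtain ⟨k, hk⟩ := hi
  refine hC.trans (mul_le_mul_of_nonneg_left ?_ hC0)
  refine le_trans ?_ (Finset.single_le_sum
    (fun k _ => expWeight_nonneg (zero_lt_one.trans hβ).le V i k) (Finset.mem_univ k))
  unfold expWeight
  have hS : (β - 1) / m * ∑ i', V i' k ≤ β - 1 := by
    rw [div_mul_eq_mul_div, div_le_iff₀ hm0]
    exact mul_le_mul_of_nonneg_left (hV k) (by linarith)
  gcongr
  · exact hβ.le
  · linarith [hp1 k]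

/-- The potential bounding the rejected volume. -/
noncomputable def volPotential {d m : ℕ} (β C : ℝ) (V : Fin m → Fin d → ℝ) : ℝ :=
  (∑ k, (m - ∑ i, V i k)) * (C * ∑ i, ∑ k, expWeight β V i k)

open Classical in
lemma exists_machine_volPotential_le {d m : ℕ} {β B C : ℝ} (hm : 1 ≤ m) (hβ : 1 < β)
    (hC0 : 0 ≤ C) (hC : 1 ≤ C * (β ^ (B - 1) * Real.exp (-(β - 1))))
    (V : Fin m → Fin d → ℝ) (p : Fin d → ℝ) (hp0 : ∀ k, 0 ≤ p k) (hp1 : ∀ k, p k ≤ 1)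
    (hV : ∀ k, ∑ i, V i k + p k ≤ m) :
    ∃ i, m * (if ∀ k, V i k + p k ≤ B then 0 else ∑ k, p k) + volPotential β C (addJob V i p) ≤
      volPotential β C V := by
  have hm0 : (0 : ℝ) < m := by exact_mod_cast hm
  have : NeZero m := ⟨by omega⟩
  have hs0 : 0 ≤ ∑ k, p k := Finset.sum_nonneg fun k _ => hp0 k
  set s := ∑ k, p k with hs
  set H := ∑ i, ∑ k, expWeight β V i k with hH
  set r := ∑ k, ((m : ℝ) - ∑ i, V i k) with hr
  have hrs : ∀ i, ∑ k, ((m : ℝ) - ∑ i', addJob V i p i' k) = r - s := by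
    intro i
    rw [hr, hs, ← Finset.sum_sub_distrib]
    exact Finset.sum_congr rfl fun k _ => by rw [sum_addJob]; ring
  have hrs0 : 0 ≤ r - s := by
    rw [hr, hs, ← Finset.sum_sub_distrib]
    exact Finset.sum_nonneg fun k _ => by linarith [hV k]
  have hrej : ∑ i, (if ∀ k, V i k + p k ≤ B then 0 else s) ≤ s * (C * H) := by
    rw [hH, Finset.mul_sum, Finset.mul_sum]
    refine Finset.sum_le_sum fun i _ => ?_
    split_ifs with h
    · exact mul_nonneg hs0 (mul_nonneg hC0
        (Finset.sum_nonneg fun k _ => expWeight_nonneg (zero_lt_one.trans hβ).le V i k))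
    · exact le_mul_of_one_le_right hs0 (one_le_sum_expWeight hm hβ hC0 hC V
        (fun k => by linarith [hV k, hp0 k]) p hp1 i h)
  have hnew : ∑ i, ∑ i', ∑ k, expWeight β (addJob V i p) i' k ≤ m * H := by
    rw [Finset.sum_comm, hH, Finset.mul_sum]
    refine Finset.sum_le_sum fun i' _ => ?_
    rw [Finset.sum_comm, Finset.mul_sum]
    exact Finset.sum_le_sum fun k _ => sum_expWeight_addJob_le hm hβ V p hp0 hp1 i' k
  have key : ∑ i, (m * (if ∀ k, V i k + p k ≤ B then 0 else s) +
      volPotential β C (addJob V i p)) ≤ ∑ _i : Fin m, volPotential β C V := by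
    simp only [volPotential, hrs, Finset.sum_add_distrib, ← Finset.mul_sum, ← hr, ← hH]
    rw [Finset.sum_const, Finset.card_univ, Fintype.card_fin, nsmul_eq_mul]
    nlinarith [mul_le_mul_of_nonneg_left hrej hm0.le,
      mul_le_mul_of_nonneg_left hnew (mul_nonneg hrs0 hC0)]
  obtain ⟨i, -, hi⟩ := Finset.exists_le_of_sum_le Finset.univ_nonempty key
  exact ⟨i, hi⟩

/-- Invariant of a phase with known makespan `1`. The ghost data are the virtual loads `V` (as if
no job were rejected), the loads `A` of the accepted jobs, and the rejected volume `G`. -/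
def PhaseInv {d m : ℕ} (β B C : ℝ) (N : Fin m → Fin d → ℝ) : Prop :=
  ∃ (V A : Fin m → Fin d → ℝ) (G : Fin m → ℝ),
    (∀ i k, 0 ≤ N i k) ∧ (∀ i k, N i k ≤ A i k + G i) ∧ (∀ i k, A i k ≤ V i k) ∧
    (∀ i k, A i k ≤ B) ∧ (∀ i, G i ≤ 2) ∧
    (∀ k, ∑ i, V i k = ∑ i, N i k) ∧ (∀ k, ∑ i, V i k ≤ m) ∧
    m * ∑ i, G i + volPotential β C V ≤ m * m

lemma PhaseInv.le {d m : ℕ} {β B C : ℝ} {N : Fin m → Fin d → ℝ} (h : PhaseInv β B C N)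
    (i : Fin m) (k : Fin d) : N i k ≤ B + 2 := by
  obtain ⟨V, A, G, -, hN, -, hA, hG, -⟩ := h
  linarith [hN i k, hA i k, hG i]

lemma phaseInv_zero {d m : ℕ} {β B C : ℝ} (hB : 0 ≤ B) (hC : d ^ 2 * C ≤ 1) :
    PhaseInv (d := d) (m := m) β B C 0 := by
  refine ⟨0, 0, 0, by simp, by simp, by simp, fun _ _ => hB, by simp, by simp,
    by simp, ?_⟩
  simp only [volPotential, expWeight]
  simp
  nlinarith [mul_le_mul_of_nonneg_left hC (mul_self_nonneg (m : ℝ))]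

lemma volPotential_nonneg {d m : ℕ} {β C : ℝ} (hβ : 0 ≤ β) (hC : 0 ≤ C)
    (V : Fin m → Fin d → ℝ) (hV : ∀ k, ∑ i, V i k ≤ m) : 0 ≤ volPotential β C V :=
  mul_nonneg (Finset.sum_nonneg fun k _ => by linarith [hV k]) (mul_nonneg hC
    (Finset.sum_nonneg fun i _ => Finset.sum_nonneg fun k _ => expWeight_nonneg hβ V i k))

lemma PhaseInv.step {d m : ℕ} {β B C : ℝ} (hm : 1 ≤ m) (hβ : 1 < β)
    (hC0 : 0 ≤ C) (hC : 1 ≤ C * (β ^ (B - 1) * Real.exp (-(β - 1))))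
    {N : Fin m → Fin d → ℝ} (h : PhaseInv β B C N)
    (p : Fin d → ℝ) (hp0 : ∀ k, 0 ≤ p k) (hp1 : ∀ k, p k ≤ 1)
    (hN : ∀ k, ∑ i, N i k + p k ≤ m) :
    ∃ i, PhaseInv β B C (addJob N i p) := by
  classical
  have hm0 : (0 : ℝ) < m := by exact_mod_cast hm
  have : NeZero m := ⟨by omega⟩
  obtain ⟨V, A, G, hN0, hNA, hAV, hAB, hG2, hVN, hVm, hpot⟩ := h
  have hV : ∀ k, ∑ i, V i k + p k ≤ m := fun k => by rw [hVN]; exact hN k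
  obtain ⟨i₀, hi₀⟩ := exists_machine_volPotential_le hm hβ hC0 hC V p hp0 hp1 hV
  have hadd : ∀ i i' k, 0 ≤ addJob N i p i' k := by
    intro i i' k
    unfold addJob
    split_ifs <;> linarith [hN0 i' k, hp0 k]
  have hsum : ∀ i k, ∑ i', addJob V i₀ p i' k = ∑ i', addJob N i p i' k := by
    intro i k; rw [sum_addJob, sum_addJob, hVN]
  have hsumm : ∀ k, ∑ i', addJob V i₀ p i' k ≤ m := by
    intro k; rw [sum_addJob]; exact hV k
  by_cases hacc : ∀ k, V i₀ k + p k ≤ B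
  · rw [if_pos hacc] at hi₀
    refine ⟨i₀, addJob V i₀ p, addJob A i₀ p, G, hadd i₀, ?_, ?_, ?_, hG2, hsum i₀, hsumm, ?_⟩
    · intro i k; unfold addJob; linarith [hNA i k]
    · intro i k; unfold addJob; linarith [hAV i k]
    · intro i k
      unfold addJob
      split_ifs with hi
      · subst hi; linarith [hAV i₀ k, hacc k]
      · linarith [hAB i k]
    · linarith
  · rw [if_neg hacc] at hi₀
    obtain ⟨i₁, hi₁⟩ := Finite.exists_min G
    have hG1 : G i₁ ≤ 1 := by
      have h1 : ∑ _i : Fin m, G i₁ ≤ ∑ i, G i := Finset.sum_le_sum fun i _ => hi₁ i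
      rw [Finset.sum_const, Finset.card_univ, Fintype.card_fin, nsmul_eq_mul] at h1
      have h2 := volPotential_nonneg (zero_lt_one.trans hβ).le hC0 V hVm
      have h3 : (m : ℝ) * ∑ i, G i ≤ m * m := by linarith
      have h4 := le_of_mul_le_mul_left h3 hm0
      have h5 : (m : ℝ) * G i₁ ≤ m * 1 := by linarith
      exact le_of_mul_le_mul_left h5 hm0
    obtain ⟨w, hw0, hw1, hpw, hws⟩ :
        ∃ w : ℝ, 0 ≤ w ∧ w ≤ 1 ∧ (∀ k, p k ≤ w) ∧ w ≤ ∑ k, p k := by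
      obtain ⟨k₀, -⟩ := not_forall.mp hacc
      have : Nonempty (Fin d) := ⟨k₀⟩
      obtain ⟨k₁, hk₁⟩ := Finite.exists_max p
      exact ⟨p k₁, hp0 _, hp1 _, hk₁,
        Finset.single_le_sum (fun k _ => hp0 k) (Finset.mem_univ k₁)⟩
    refine ⟨i₁, addJob V i₀ p, A, fun i => G i + if i₁ = i then w else 0, hadd i₁, ?_, ?_, hAB,
      ?_, hsum i₁, hsumm, ?_⟩
    · intro i k
      unfold addJob
      dsimp only
      split_ifs <;> linarith [hNA i k, hpw k]
    · intro i k
      unfold addJob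
      split_ifs <;> linarith [hAV i k, hp0 k]
    · intro i
      dsimp only
      split_ifs with hi
      · subst hi; linarith
      · linarith [hG2 i]
    · rw [Finset.sum_add_distrib, Finset.sum_ite_eq]
      simp only [Finset.mem_univ, if_true]
      nlinarith [mul_le_mul_of_nonneg_left hws hm0.le]

/-- Invariant of the algorithm that guesses the makespan `T` by doubling, given a lower bound `Q`
on the optimum. -/
def GuessInv {d m : ℕ} (β B C : ℝ) (Q : ℝ) (L : Fin m → Fin d → ℝ) : Prop :=
  ∃ (T : ℝ) (O N : Fin m → Fin d → ℝ), 0 ≤ T ∧ T ≤ 2 * Q ∧ PhaseInv β B C N ∧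
    (∀ i k, 0 ≤ O i k) ∧ (∀ i k, O i k ≤ (B + 2) * T) ∧ ∀ i k, L i k = O i k + T * N i k

lemma GuessInv.le_mul_guess {d m : ℕ} {β B C T : ℝ} {O N : Fin m → Fin d → ℝ} (hT : 0 ≤ T)
    (hN : PhaseInv β B C N) (hO : ∀ i k, O i k ≤ (B + 2) * T) (i : Fin m) (k : Fin d) :
    O i k + T * N i k ≤ 2 * (B + 2) * T := by
  nlinarith [hO i k, mul_le_mul_of_nonneg_left (hN.le i k) hT]

lemma GuessInv.le {d m : ℕ} {β B C Q : ℝ} (hB : 0 ≤ B) {L : Fin m → Fin d → ℝ}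
    (h : GuessInv β B C Q L) (i : Fin m) (k : Fin d) : L i k ≤ 4 * (B + 2) * Q := by
  obtain ⟨T, O, N, hT, hTQ, hN, -, hO, hL⟩ := h
  rw [hL]
  nlinarith [GuessInv.le_mul_guess hT hN hO i k]

lemma guessInv_zero {d m : ℕ} {β B C : ℝ} (hB : 0 ≤ B) (hC : d ^ 2 * C ≤ 1) :
    GuessInv (d := d) (m := m) β B C 0 0 :=
  ⟨0, 0, 0, le_rfl, by simp, phaseInv_zero hB hC, by simp, by simp, by simp⟩

lemma GuessInv.step {d m : ℕ} {β B C : ℝ} (hm : 1 ≤ m) (hβ : 1 < β) (hB : 0 ≤ B)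
    (hC0 : 0 ≤ C) (hC : 1 ≤ C * (β ^ (B - 1) * Real.exp (-(β - 1)))) (hCd : d ^ 2 * C ≤ 1)
    {Q Q' : ℝ} {L : Fin m → Fin d → ℝ} (h : GuessInv β B C Q L) (hQ : Q ≤ Q')
    (p : Fin d → ℝ) (hp0 : ∀ k, 0 ≤ p k) (hpQ : ∀ k, p k ≤ Q')
    (hLQ : ∀ k, ∑ i, L i k + p k ≤ m * Q') :
    ∃ i, GuessInv β B C Q' (addJob L i p) := by
  have hm1 : (1 : ℝ) ≤ m := by exact_mod_cast hm
  obtain ⟨T, O, N, hT, hTQ, hN, hO0, hO, hL⟩ := h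
  have hN0 : ∀ i k, 0 ≤ N i k := by
    obtain ⟨V, A, G, h, -⟩ := hN
    exact h
  by_cases hle : Q' ≤ T
  · have hpT : ∀ k, p k = T * (p k / T) := by
      intro k
      rcases hT.eq_or_lt with h0 | h0
      · have := hp0 k; have := hpQ k; subst h0; simp; linarith
      · field_simp
    have hsum : ∀ k, ∑ i, N i k + p k / T ≤ m := by
      intro k
      rcases hT.eq_or_lt with h0 | h0
      · obtain ⟨V, A, G, -, -, -, -, -, hVN, hVm, -⟩ := hN
        subst h0
        simpa [← hVN] using hVm k
      · have h1 : T * ∑ i, N i k ≤ ∑ i, L i k := by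
          rw [Finset.mul_sum]
          exact Finset.sum_le_sum fun i _ => by linarith [hL i k, hO0 i k]
        refine le_of_mul_le_mul_left ?_ h0
        rw [mul_add, ← hpT]
        nlinarith [hLQ k]
    obtain ⟨i, hi⟩ := hN.step hm hβ hC0 hC (fun k => p k / T)
      (fun k => div_nonneg (hp0 k) hT)
      (fun k => div_le_one_of_le₀ ((hpQ k).trans hle) hT) hsum
    refine ⟨i, T, O, _, hT, by linarith, hi, hO0, hO, fun i' k => ?_⟩
    unfold addJob
    rw [hL, mul_add, mul_ite, ← hpT, mul_zero, add_assoc]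
  · push Not at hle
    have hQ0 : 0 < 2 * Q' := by linarith
    obtain ⟨i, hi⟩ := (phaseInv_zero hB hCd).step hm hβ hC0 hC (fun k => p k / (2 * Q'))
      (fun k => div_nonneg (hp0 k) hQ0.le)
      (fun k => div_le_one_of_le₀ (by linarith [hpQ k]) hQ0.le)
      (fun k => by
        have := div_le_one_of_le₀ (a := p k) (b := 2 * Q') (by linarith [hpQ k]) hQ0.le
        simp; linarith)
    refine ⟨i, 2 * Q', L, _, hQ0.le, le_rfl, hi, fun i k => ?_, fun i k => ?_, fun i' k => ?_⟩
    · rw [hL]; exact add_nonneg (hO0 i k) (mul_nonneg hT (hN0 i k))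
    · have := GuessInv.le_mul_guess hT hN hO i k
      rw [hL]
      nlinarith
    · unfold addJob
      dsimp only
      have : 2 * Q' * (p k / (2 * Q')) = p k := mul_div_cancel₀ _ hQ0.ne'
      rw [mul_add, mul_ite, this]
      simp

/-- The load matrix after an online algorithm processed `σ`, over the reals. -/
def onlineLoad {d m : ℕ} (A : List (Fin d → NNReal) → Fin m) (σ : List (Fin d → NNReal)) :
    Fin m → Fin d → ℝ :=
  fun i k => idLoad σ (idOnline A σ) i k

lemma idLoad_idOnline_eq_sum_range {d m : ℕ} (A : List (Fin d → NNReal) → Fin m)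
    (σ : List (Fin d → NNReal)) (i : Fin m) (k : Fin d) :
    idLoad σ (idOnline A σ) i k =
      ∑ j ∈ Finset.range σ.length, if A (σ.take (j + 1)) = i then σ.getD j 0 k else 0 := by
  rw [← Fin.sum_univ_eq_sum_range
    (fun j => if A (σ.take (j + 1)) = i then σ.getD j 0 k else 0)]
  refine Finset.sum_congr rfl fun j _ => ?_
  rw [List.getD_eq_getElem _ _ j.2]
  rfl

lemma onlineLoad_append {d m : ℕ} (A : List (Fin d → NNReal) → Fin m)
    (σ : List (Fin d → NNReal)) (p : Fin d → NNReal) :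
    onlineLoad A (σ ++ [p]) = addJob (onlineLoad A σ) (A (σ ++ [p])) (fun k => p k) := by
  funext i k
  simp only [onlineLoad, addJob, idLoad_idOnline_eq_sum_range]
  rw [List.length_append, List.length_singleton, Finset.sum_range_succ, NNReal.coe_add]
  congr 2
  · refine Finset.sum_congr rfl fun j hj => ?_
    have hj := Finset.mem_range.mp hj
    rw [List.take_append_of_le_length (by omega), List.getD_append _ _ _ _ hj]
  · rw [List.take_of_length_le (by simp)]
    split_ifs <;> simp

/-- A greedy invariant yields a deterministic online algorithm maintaining it. -/
lemma exists_online_of_invariant {d m : ℕ}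
    (P : List (Fin d → NNReal) → (Fin m → Fin d → ℝ) → Prop) (hm : 1 ≤ m) (h0 : P [] 0)
    (hstep : ∀ σ L p, P σ L → ∃ i, P (σ ++ [p]) (addJob L i fun k => p k)) :
    ∃ A : List (Fin d → NNReal) → Fin m, ∀ σ, P σ (onlineLoad A σ) := by
  have : Nonempty (Fin m) := ⟨⟨0, hm⟩⟩
  choose! f hf using hstep
  let st : List (Fin d → NNReal) → Fin m → Fin d → ℝ := fun r =>
    List.rec (motive := fun _ => Fin m → Fin d → ℝ) 0
      (fun p r L => addJob L (f r.reverse L p) fun k => p k) r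
  let A : List (Fin d → NNReal) → Fin m := fun σ =>
    match σ.reverse with
    | [] => ⟨0, hm⟩
    | p :: r => f r.reverse (st r) p
  have hA : ∀ σ, onlineLoad A σ = st σ.reverse := by
    intro σ
    induction σ using List.reverseRecOn with
    | nil => funext i k; simp [onlineLoad, idLoad, st]
    | append_singleton σ p ih =>
      rw [onlineLoad_append, ih, List.reverse_append]
      simp [A, st]
  refine ⟨A, fun σ => ?_⟩
  rw [hA]
  induction σ using List.reverseRecOn with
  | nil => exact h0
  | append_singleton σ p ih =>
    have := hf σ _ p ih
    simpa [st] using this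

lemma sum_idLoad {d m : ℕ} (σ : List (Fin d → NNReal)) (f : Fin σ.length → Fin m)
    (k : Fin d) : ∑ i, idLoad σ f i k = (σ.map (· k)).sum := by
  unfold idLoad
  rw [Finset.sum_comm]
  simp [← Fin.sum_univ_fun_getElem]

/-- The largest load of a single job or average machine load over all dimensions: a lower bound on
the optimal makespan. -/
noncomputable def optLowerBound {d : ℕ} (m : ℕ) (σ : List (Fin d → NNReal)) : NNReal :=
  Finset.univ.sup fun k => max ((σ.map (· k)).sum / m) ((σ.map (· k)).foldr max 0)

lemma le_foldr_max {l : List NNReal} {x : NNReal} (hx : x ∈ l) : x ≤ l.foldr max 0 := by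
  induction l with
  | nil => simp at hx
  | cons y l ih =>
    rcases List.mem_cons.mp hx with rfl | h
    · simp
    · exact (ih h).trans (by simp)

lemma foldr_max_le {l : List NNReal} {b : NNReal} (h : ∀ x ∈ l, x ≤ b) :
    l.foldr max 0 ≤ b := by
  induction l with
  | nil => simp
  | cons y l ih =>
    simp only [List.foldr_cons, max_le_iff]
    exact ⟨h y (by simp), ih fun x hx => h x (by simp [hx])⟩

lemma sum_le_mul_optLowerBound {d m : ℕ} (hm : 1 ≤ m) (σ : List (Fin d → NNReal)) (k : Fin d) :
    (σ.map (· k)).sum ≤ m * optLowerBound m σ := by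
  have hm0 : (0 : NNReal) < m := by exact_mod_cast hm
  rw [← div_le_iff₀' hm0]
  exact (le_max_left _ _).trans
    (Finset.le_sup (f := fun k => max ((σ.map (· k)).sum / m) ((σ.map (· k)).foldr max 0))
      (Finset.mem_univ k))

lemma le_optLowerBound {d : ℕ} (m : ℕ) {σ : List (Fin d → NNReal)} {p : Fin d → NNReal}
    (hp : p ∈ σ) (k : Fin d) : p k ≤ optLowerBound m σ :=
  (le_foldr_max (List.mem_map_of_mem hp)).trans <| (le_max_right _ _).trans
    (Finset.le_sup (f := fun k => max ((σ.map (· k)).sum / m) ((σ.map (· k)).foldr max 0))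
      (Finset.mem_univ k))

lemma optLowerBound_le {d m : ℕ} (hm : 1 ≤ m) {σ : List (Fin d → NNReal)} {b : NNReal}
    (hsum : ∀ k, (σ.map (· k)).sum ≤ m * b) (hmax : ∀ p ∈ σ, ∀ k, p k ≤ b) :
    optLowerBound m σ ≤ b := by
  have hm0 : (0 : NNReal) < m := by exact_mod_cast hm
  refine Finset.sup_le fun k _ => max_le ((div_le_iff₀' hm0).mpr (hsum k)) (foldr_max_le ?_)
  intro x hx
  obtain ⟨p, hp, rfl⟩ := List.mem_map.mp hx
  exact hmax p hp k

lemma optLowerBound_le_append {d m : ℕ} (hm : 1 ≤ m) (σ : List (Fin d → NNReal))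
    (p : Fin d → NNReal) : optLowerBound m σ ≤ optLowerBound m (σ ++ [p]) := by
  refine optLowerBound_le hm (fun k => ?_) fun q hq k => le_optLowerBound m (by simp [hq]) k
  refine le_trans ?_ (sum_le_mul_optLowerBound hm (σ ++ [p]) k)
  simp

lemma optLowerBound_le_opt {d m : ℕ} (hm : 1 ≤ m) (σ : List (Fin d → NNReal)) :
    (optLowerBound m σ : ℝ) ≤
      ⨅ f : Fin σ.length → Fin m, ⨆ i : Fin m, ⨆ k : Fin d, (idLoad σ f i k : ℝ) := by
  have : Nonempty (Fin m) := ⟨⟨0, hm⟩⟩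
  refine le_ciInf fun f => ?_
  have hle : ∀ i k, (idLoad σ f i k : ℝ) ≤
      ⨆ i : Fin m, ⨆ k : Fin d, (idLoad σ f i k : ℝ) := fun i k =>
    (le_ciSup (f := fun k => (idLoad σ f i k : ℝ)) (Set.finite_range _).bddAbove k).trans
      (le_ciSup (f := fun i => ⨆ k, (idLoad σ f i k : ℝ)) (Set.finite_range _).bddAbove i)
  have h0 : 0 ≤ ⨆ i : Fin m, ⨆ k : Fin d, (idLoad σ f i k : ℝ) :=
    Real.iSup_nonneg fun i => Real.iSup_nonneg fun k => NNReal.coe_nonneg _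
  generalize (⨆ i : Fin m, ⨆ k : Fin d, (idLoad σ f i k : ℝ)) = b at hle h0
  lift b to NNReal using h0
  norm_cast at hle ⊢
  refine optLowerBound_le hm (fun k => ?_) fun p hp k => ?_
  · rw [← sum_idLoad σ f k]
    simpa using Finset.sum_le_card_nsmul Finset.univ _ b fun i _ => hle i k
  · obtain ⟨j, rfl⟩ := List.get_of_mem hp
    refine le_trans ?_ (hle (f j) k)
    have := Finset.single_le_sum (f := fun j' => if f j' = f j then σ.get j' k else 0)
      (fun _ _ => zero_le) (Finset.mem_univ j)
    simpa [idLoad] using this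

lemma exists_online_le_optLowerBound {d m : ℕ} {β B C : ℝ} (hm : 1 ≤ m) (hβ : 1 < β)
    (hB : 0 ≤ B) (hC0 : 0 ≤ C) (hC : 1 ≤ C * (β ^ (B - 1) * Real.exp (-(β - 1))))
    (hCd : d ^ 2 * C ≤ 1) :
    ∃ A : List (Fin d → NNReal) → Fin m, ∀ σ i k,
      (idLoad σ (idOnline A σ) i k : ℝ) ≤ 4 * (B + 2) * optLowerBound m σ := by
  obtain ⟨A, hA⟩ := exists_online_of_invariant (d := d) (m := m)
    (fun σ L => GuessInv β B C (optLowerBound m σ) L ∧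
      ∀ k, ∑ i, L i k = ((σ.map (· k)).sum : NNReal)) hm
    ⟨by
      have h0 : optLowerBound (d := d) m [] = 0 :=
        le_antisymm (optLowerBound_le hm (by simp) (by simp)) zero_le
      rw [h0]
      exact guessInv_zero hB hCd, by simp⟩ (by
      rintro σ L p ⟨hL, hsum⟩
      have hnew : ∀ k, ∑ i, L i k + p k = (((σ ++ [p]).map (· k)).sum : NNReal) := fun k => by
        rw [hsum]; simp
      obtain ⟨i, hi⟩ := hL.step hm hβ hB hC0 hC hCd
        (NNReal.coe_le_coe.mpr (optLowerBound_le_append hm σ p)) (fun k => p k)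
        (fun k => NNReal.coe_nonneg _)
        (fun k => NNReal.coe_le_coe.mpr (le_optLowerBound m (by simp) k))
        (fun k => by
          rw [hnew]
          exact_mod_cast sum_le_mul_optLowerBound hm (σ ++ [p]) k)
      exact ⟨i, hi, fun k => by rw [sum_addJob, hnew]⟩)
  exact ⟨A, fun σ i k => (hA σ).1.le hB i k⟩

/-- `O(log d / log log d)`-competitive online algorithm for vector scheduling on
identical machines (VSMAX-I): there is `c > 0` such that for every `m ≥ 1` and
`d ≥ 3` there is a deterministic online algorithm whose maximum machine load in
every dimension is at most `c · (log d / log log d)` times the optimal offline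
makespan `OPT(σ) = ⨅ f, ⨆ i k, Λᶠᵢ(k)`. -/
theorem vsmaxI_upperBound :
    ∃ c : ℝ, 0 < c ∧ ∀ m d : ℕ, 1 ≤ m → 3 ≤ d →
      ∃ A : List (Fin d → NNReal) → Fin m,
        ∀ σ : List (Fin d → NNReal), ∀ i : Fin m, ∀ k : Fin d,
          (idLoad σ (idOnline A σ) i k : ℝ) ≤
            c * (Real.log d / Real.log (Real.log d)) *
              ⨅ f : Fin σ.length → Fin m, ⨆ i' : Fin m, ⨆ k' : Fin d,
                (idLoad σ f i' k' : ℝ) := by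
  refine ⟨24, by norm_num, fun m d hm hd => ?_⟩
  have hd0 : (0 : ℝ) < d := by positivity
  have hb : 1 < Real.log d := by
    rw [Real.lt_log_iff_exp_lt hd0]
    have : (3 : ℝ) ≤ d := by exact_mod_cast hd
    linarith [Real.exp_one_lt_d9]
  set b := Real.log d with hbd
  have hb0 : 0 < b := zero_lt_one.trans hb
  have hl : 0 < Real.log b := Real.log_pos hb
  have hr : 1 ≤ b / Real.log b := by
    rw [one_le_div hl]
    linarith [Real.log_le_sub_one_of_pos hb0]
  have hbB : b ^ (1 + 3 * (b / Real.log b) - 1) = Real.exp (3 * b) := by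
    rw [Real.rpow_def_of_pos hb0]
    congr 1
    field_simp
    ring
  have hdexp : (d : ℝ) = Real.exp b := (Real.exp_log hd0).symm
  obtain ⟨A, hA⟩ := exists_online_le_optLowerBound (d := d) (B := 1 + 3 * (b / Real.log b))
    (C := Real.exp (-(2 * b) - 1)) hm hb (by positivity) (Real.exp_pos _).le
    (by
      rw [hbB, ← Real.exp_add, ← Real.exp_add]
      exact Real.one_le_exp (by linarith))
    (by
      rw [hdexp, ← Real.exp_nat_mul, ← Real.exp_add]
      exact Real.exp_le_one_iff.mpr (by push_cast; linarith))
  refine ⟨A, fun σ i k => (hA σ i k).trans ?_⟩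
  exact mul_le_mul (by linarith) (optLowerBound_le_opt hm σ) (NNReal.coe_nonneg _) (by positivity)
end

section
/- For every real r ≥ 1 there is a constant c > 0 such that for all sufficiently large integers d there is a number of machines m with the following property: for every deterministic online algorithm A for vector scheduling on m identical machines with d dimensions, there exists a finite job sequence σ and a dimension k ∈ [d] such that ‖Λ^A(k)‖_r ≥ c · ((log d)/(log log d))^{(r−1)/r} · OPT_{r,k}(σ), where OPT_{r,k}(σ) is the minimum over all assignments f of σ of ‖Λ^f(k)‖_r. -/
/-- The `L_r` norm `(∑ i, Λᶠᵢ(k)^r)^(1/r)` of the machine loads in dimension `k`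
under the assignment `f`. -/
noncomputable def idNorm {d m : ℕ} (σ : List (Fin d → NNReal))
    (f : Fin σ.length → Fin m) (k : Fin d) (r : ℝ) : ℝ :=
  (∑ i : Fin m, (idLoad σ f i k : ℝ) ^ r) ^ (1 / r)

/-- If the jobs with nonzero load in dimension `k` are the unit jobs `g 0, …, g (m - 1)`, then
assigning them to distinct machines yields `L_r` norm `m ^ (1 / r)`. -/
lemma iInf_idNorm_le {d m : ℕ} {r : ℝ} (σ : List (Fin d → NNReal)) (k : Fin d)
    (i₀ : Fin m) (g : Fin m → Fin σ.length) (hg : Function.Injective g)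
    (hk : ∀ j, σ.get j k = if ∃ i, g i = j then 1 else 0) :
    (⨅ f : Fin σ.length → Fin m, idNorm σ f k r) ≤ (m : ℝ) ^ (1 / r) := by
  classical
  have hbdd : BddBelow (Set.range fun f : Fin σ.length → Fin m => idNorm σ f k r) := by
    refine ⟨0, ?_⟩
    rintro _ ⟨f, rfl⟩
    simp only [idNorm]
    positivity
  let f : Fin σ.length → Fin m := fun j => if h : ∃ i, g i = j then h.choose else i₀
  have hfg : ∀ i, f (g i) = i := by
    intro i
    have h : ∃ i', g i' = g i := ⟨i, rfl⟩
    simp only [f, dif_pos h]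
    exact hg h.choose_spec
  have hload : ∀ i, idLoad σ f i k = 1 := by
    intro i
    unfold idLoad
    rw [Finset.sum_eq_single (g i)]
    · rw [if_pos (hfg i), hk, if_pos ⟨i, rfl⟩]
    · intro j _ hj
      split_ifs with h
      · rw [hk, if_neg]
        rintro ⟨i', rfl⟩
        rw [hfg] at h
        exact hj (by rw [h])
      · rfl
    · simp
  refine (ciInf_le hbdd f).trans (le_of_eq ?_)
  simp [idNorm, hload]

/-- If the unit jobs `g 0, …, g (m - 1)` are all assigned to the same machine, the `L_r` norm
is at least `m`. -/
lemma le_idNorm {d m : ℕ} {r : ℝ} (hr : 1 ≤ r) (σ : List (Fin d → NNReal)) (k : Fin d)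
    (i₀ : Fin m) (g : Fin m → Fin σ.length) (hg : Function.Injective g)
    (hk : ∀ i, σ.get (g i) k = 1) (F : Fin σ.length → Fin m) (hF : ∀ i, F (g i) = i₀) :
    (m : ℝ) ≤ idNorm σ F k r := by
  have hload : (m : NNReal) ≤ idLoad σ F i₀ k := by
    unfold idLoad
    calc (m : NNReal) = ∑ i : Fin m, if F (g i) = i₀ then σ.get (g i) k else 0 := by
          simp [hF, hk, -List.get_eq_getElem]
      _ = ∑ j ∈ Finset.univ.map ⟨g, hg⟩, if F j = i₀ then σ.get j k else 0 := by
          rw [Finset.sum_map]; rfl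
      _ ≤ _ := Finset.sum_le_sum_of_subset (Finset.subset_univ _)
  have hload' : (m : ℝ) ≤ idLoad σ F i₀ k := by exact_mod_cast hload
  have hr0 : r ≠ 0 := by linarith
  calc (m : ℝ) ≤ idLoad σ F i₀ k := hload'
    _ = ((idLoad σ F i₀ k : ℝ) ^ r) ^ (1 / r) := by
        rw [one_div, Real.rpow_rpow_inv (NNReal.coe_nonneg _) hr0]
    _ ≤ _ := by
        unfold idNorm
        refine Real.rpow_le_rpow (by positivity) ?_ (by positivity)
        exact Finset.single_le_sum (f := fun i => (idLoad σ F i k : ℝ) ^ r)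
          (fun i _ => by positivity) (Finset.mem_univ i₀)

/-- With a dimension for each `m`-tuple of jobs among `m * m` jobs, every online algorithm on `m`
machines puts all unit jobs of some dimension on a single machine. -/
lemma exists_le_idNorm_idOnline {d m : ℕ} {r : ℝ} (hr : 1 ≤ r) (hm : 0 < m)
    (hd : (m * m) ^ m ≤ d) (A : List (Fin d → NNReal) → Fin m) :
    ∃ σ : List (Fin d → NNReal), ∃ k : Fin d,
      (⨅ f : Fin σ.length → Fin m, idNorm σ f k r) ≤ (m : ℝ) ^ (1 / r) ∧
        (m : ℝ) ≤ idNorm σ (idOnline A σ) k r := by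
  classical
  obtain ⟨e⟩ : Nonempty ((Fin m → Fin (m * m)) ↪ Fin d) :=
    Function.Embedding.nonempty_of_card_le (by simpa using hd)
  obtain ⟨σ, hlen, hσ⟩ : ∃ σ : List (Fin d → NNReal), ∃ hlen : σ.length = m * m,
      ∀ j g, σ.get j (e g) = if ∃ i, g i = Fin.cast hlen j then 1 else 0 := by
    refine ⟨List.ofFn fun j k => if ∃ g, e g = k ∧ ∃ i, g i = j then 1 else 0, by simp, ?_⟩
    intro j g
    simp [Fin.cast]
  have : Nonempty (Fin m) := ⟨⟨0, hm⟩⟩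
  obtain ⟨i₀, hi₀⟩ := Fintype.exists_le_card_fiber_of_mul_le_card (n := m) (idOnline A σ)
    (by simp [hlen])
  obtain ⟨t, hts, htm⟩ := Finset.exists_subset_card_eq hi₀
  let g : Fin m ↪o Fin σ.length := t.orderEmbOfFin htm
  have hgF : ∀ i, idOnline A σ (g i) = i₀ := fun i => by
    simpa using hts (t.orderEmbOfFin_mem htm i)
  have hk : ∀ j, σ.get j (e fun i => Fin.cast hlen (g i)) = if ∃ i, g i = j then 1 else 0 := by
    intro j
    rw [hσ]
    simp
  refine ⟨σ, e fun i => Fin.cast hlen (g i), iInf_idNorm_le σ _ i₀ g g.injective hk,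
    le_idNorm hr σ _ i₀ g g.injective (fun i => ?_) _ hgF⟩
  rw [hk, if_pos ⟨i, rfl⟩]

/-- For large `d` there is `m` of order `log d / log (log d)` with `m ^ (2 * m) ≤ d`. -/
lemma exists_nat_mul_self_pow_le {d : ℕ} (hd : Real.exp 64 ≤ d) :
    ∃ m : ℕ, 0 < m ∧ (m * m) ^ m ≤ d ∧ 0 ≤ Real.log d / Real.log (Real.log d) ∧
      Real.log d / Real.log (Real.log d) ≤ 4 * m := by
  have hd0 : (0 : ℝ) < d := (Real.exp_pos _).trans_le hd
  set y := Real.log d with hy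
  have hy64 : 64 ≤ y := (Real.le_log_iff_exp_le hd0).2 hd
  have hlog1 : 1 ≤ Real.log y := by
    rw [Real.le_log_iff_exp_le (by linarith)]
    linarith [Real.exp_one_lt_d9]
  have hsqrt : 8 ≤ √y := Real.le_sqrt_of_sq_le (by linarith)
  have hsq : √y * √y = y := Real.mul_self_sqrt (by linarith)
  have hlog2 : Real.log y ≤ 2 * √y := by
    have h := Real.log_le_sub_one_of_pos (x := √y) (by linarith)
    rw [Real.log_sqrt (by linarith)] at h
    linarith
  set L := y / Real.log y with hL
  have hL4 : 4 ≤ L := by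
    rw [hL, le_div_iff₀ (by linarith)]
    nlinarith
  have hLy : L ≤ y := div_le_self (by linarith) hlog1
  have hLlog : L * Real.log y = y := div_mul_cancel₀ _ (by linarith)
  have hm1 : L / 4 ≤ ⌈L / 4⌉₊ := Nat.le_ceil _
  have hm2 : (⌈L / 4⌉₊ : ℝ) < L / 4 + 1 := Nat.ceil_lt_add_one (by linarith)
  have hmpos : 0 < ⌈L / 4⌉₊ := Nat.ceil_pos.2 (by linarith)
  refine ⟨⌈L / 4⌉₊, hmpos, ?_, by linarith, by linarith⟩
  generalize ⌈L / 4⌉₊ = m at *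
  have hm0 : (0 : ℝ) < m := by exact_mod_cast hmpos
  have hlogm : Real.log m ≤ Real.log y := Real.log_le_log hm0 (by linarith)
  have key : Real.log (((m : ℝ) * m) ^ m) ≤ Real.log d := by
    rw [Real.log_pow, Real.log_mul hm0.ne' hm0.ne', ← hy]
    calc (m : ℝ) * (Real.log m + Real.log m) ≤ (L / 2) * (Real.log y + Real.log y) := by
          gcongr
          linarith
      _ = y := by linarith
  have := (Real.log_le_log_iff (by positivity) hd0).1 key
  exact_mod_cast this

/-- Lower bound of `Ω((log d / log log d)^((r-1)/r))` for the `L_r` norm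
objective in online vector scheduling on identical machines: for every `r ≥ 1`
there is `c > 0` such that for all sufficiently large `d` there is a number of
machines `m` so that every deterministic online algorithm `A` admits a job
sequence `σ` and a dimension `k` on which the `L_r` norm achieved by `A` is at
least `c · (log d / log log d)^((r-1)/r)` times the optimal offline `L_r` norm
in dimension `k`. -/
theorem vsallI_lowerBound :
    ∀ r : ℝ, 1 ≤ r →
      ∃ c : ℝ, 0 < c ∧ ∃ D : ℕ, ∀ d : ℕ, D ≤ d →
        ∃ m : ℕ, 0 < m ∧
          ∀ A : List (Fin d → NNReal) → Fin m,
            ∃ σ : List (Fin d → NNReal), ∃ k : Fin d,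
              c * (Real.log d / Real.log (Real.log d)) ^ ((r - 1) / r) *
                  (⨅ f : Fin σ.length → Fin m, idNorm σ f k r) ≤
                idNorm σ (idOnline A σ) k r := by
  intro r hr
  refine ⟨1 / 4, by norm_num, ⌈Real.exp 64⌉₊, fun d hd => ?_⟩
  obtain ⟨m, hm, hmd, hL0, hL⟩ := exists_nat_mul_self_pow_le (Nat.ceil_le.1 hd)
  refine ⟨m, hm, fun A => ?_⟩
  obtain ⟨σ, k, hopt, halg⟩ := exists_le_idNorm_idOnline hr hm hmd A
  refine ⟨σ, k, le_trans ?_ halg⟩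
  set L := Real.log d / Real.log (Real.log d)
  have hr0 : 0 < r := by linarith
  have hm0 : (0 : ℝ) < m := by exact_mod_cast hm
  have hα0 : 0 ≤ (r - 1) / r := div_nonneg (by linarith) hr0.le
  have hα1 : (r - 1) / r ≤ 1 := (div_le_one hr0).2 (by linarith)
  have hopt0 : 0 ≤ ⨅ f : Fin σ.length → Fin m, idNorm σ f k r :=
    Real.iInf_nonneg fun f => by unfold idNorm; positivity
  have h4 : (4 : ℝ) ^ ((r - 1) / r) ≤ 4 := by
    simpa using Real.rpow_le_rpow_of_exponent_le (by norm_num : (1 : ℝ) ≤ 4) hα1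
  calc 1 / 4 * L ^ ((r - 1) / r) * (⨅ f : Fin σ.length → Fin m, idNorm σ f k r)
      ≤ 1 / 4 * (4 * (m : ℝ)) ^ ((r - 1) / r) * (m : ℝ) ^ (1 / r) := by gcongr
    _ = 1 / 4 * (4 : ℝ) ^ ((r - 1) / r) * ((m : ℝ) ^ ((r - 1) / r) * (m : ℝ) ^ (1 / r)) := by
        rw [Real.mul_rpow (by norm_num) hm0.le]
        ring
    _ = 1 / 4 * (4 : ℝ) ^ ((r - 1) / r) * m := by
        rw [← Real.rpow_add hm0, show (r - 1) / r + 1 / r = 1 by field_simp; ring,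
          Real.rpow_one]
    _ ≤ 1 / 4 * 4 * m := by gcongr
    _ = m := by ring
end

section
/- There is a constant c > 0 such that for every number of machines m ≥ 2, every number of dimensions d ≥ 1, and every family of norms r_1, …, r_d with 1 ≤ r_k ≤ log m for every k ∈ [d], there exists a deterministic online algorithm A (which may depend on m, d, and r_1, …, r_d) for vector scheduling on m unrelated machines with d dimensions with the following guarantee: for every finite job sequence σ, if there exists an assignment g of σ to machines with ‖Λ^g(k)‖_{r_k} ≤ 1 for every dimension k ∈ [d], then the assignment produced by A satisfies ‖Λ^A(k)‖_{r_k} ≤ c · (r_k + log d) for every dimension k ∈ [d]. -/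
/-- Unrelated machines: load of machine `i` in dimension `k` when the jobs of `σ`
(each an `m × d` matrix of nonnegative loads, `p j i k` being the load job `j`
places on machine `i` in dimension `k`) are assigned via `f`. -/
def uLoad {m d : ℕ} (σ : List (Fin m → Fin d → NNReal))
    (f : Fin σ.length → Fin m) (i : Fin m) (k : Fin d) : NNReal :=
  ∑ j : Fin σ.length, if f j = i then σ.get j i k else 0

/-- The assignment produced by a deterministic online algorithm `A` on the job
sequence `σ`. -/
def uOnline {m d : ℕ} (A : List (Fin m → Fin d → NNReal) → Fin m)
    (σ : List (Fin m → Fin d → NNReal)) : Fin σ.length → Fin m :=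
  fun j => A (σ.take (j.1 + 1))

/-- The `L_r` norm `(∑ i, Λᶠᵢ(k)^r)^(1/r)` of the machine loads in dimension `k`
under the assignment `f`. -/
noncomputable def uNorm {m d : ℕ} (σ : List (Fin m → Fin d → NNReal))
    (f : Fin σ.length → Fin m) (k : Fin d) (r : ℝ) : ℝ :=
  (∑ i : Fin m, (uLoad σ f i k : ℝ) ^ r) ^ (1 / r)

/-- Convex powers have increasing increments. -/
lemma rpow_increment_mono {s a b δ : ℝ} (hs : 1 ≤ s) (ha : 0 ≤ a) (hab : a ≤ b) (hδ : 0 ≤ δ) :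
    (a + δ) ^ s - a ^ s ≤ (b + δ) ^ s - b ^ s := by
  rcases hδ.eq_or_lt with rfl | hδ
  · simp
  have hD : 0 < b - a + δ := by linarith
  have hconv := (convexOn_rpow hs).2
  have hab' : (0 : ℝ) ≤ b - a := by linarith
  have hsum : (b - a) / (b - a + δ) + δ / (b - a + δ) = 1 := by field_simp
  have h₁ := hconv (Set.mem_Ici.2 ha) (Set.mem_Ici.2 (by linarith : 0 ≤ b + δ))
    (by positivity : 0 ≤ (b - a) / (b - a + δ)) (by positivity : 0 ≤ δ / (b - a + δ)) hsum
  have h₂ := hconv (Set.mem_Ici.2 (by linarith : 0 ≤ b + δ)) (Set.mem_Ici.2 ha)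
    (by positivity : 0 ≤ (b - a) / (b - a + δ)) (by positivity : 0 ≤ δ / (b - a + δ)) hsum
  simp only [smul_eq_mul] at h₁ h₂
  have e₁ : (b - a) / (b - a + δ) * a + δ / (b - a + δ) * (b + δ) = a + δ := by
    field_simp; ring
  have e₂ : (b - a) / (b - a + δ) * (b + δ) + δ / (b - a + δ) * a = b := by
    field_simp; ring
  rw [e₁] at h₁
  rw [e₂] at h₂
  have h := add_le_add h₁ h₂
  have e₃ : (b - a) / (b - a + δ) * a ^ s + δ / (b - a + δ) * (b + δ) ^ s +
      ((b - a) / (b - a + δ) * (b + δ) ^ s + δ / (b - a + δ) * a ^ s) =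
      ((b - a) / (b - a + δ) + δ / (b - a + δ)) * (a ^ s + (b + δ) ^ s) := by ring
  rw [e₃, hsum, one_mul] at h
  linarith

/-- Sums of powers, raised to a further power, have increasing increments. -/
lemma sum_rpow_rpow_increment_mono {ι : Type*} [Fintype ι] {r s : ℝ} (hr : 1 ≤ r) (hs : 1 ≤ s)
    {x y z : ι → ℝ} (hx : 0 ≤ x) (hxy : x ≤ y) (hz : 0 ≤ z) :
    (∑ i, (x i + z i) ^ r) ^ s - (∑ i, x i ^ r) ^ s ≤
      (∑ i, (y i + z i) ^ r) ^ s - (∑ i, y i ^ r) ^ s := by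
  have hr0 : 0 ≤ r := by linarith
  have hinc : (∑ i, (x i + z i) ^ r) - ∑ i, x i ^ r ≤ (∑ i, (y i + z i) ^ r) - ∑ i, y i ^ r := by
    rw [← Finset.sum_sub_distrib, ← Finset.sum_sub_distrib]
    exact Finset.sum_le_sum fun i _ => rpow_increment_mono hr (hx i) (hxy i) (hz i)
  have hS : ∑ i, x i ^ r ≤ ∑ i, y i ^ r :=
    Finset.sum_le_sum fun i _ => Real.rpow_le_rpow (hx i) (hxy i) hr0
  have hS0 : 0 ≤ ∑ i, x i ^ r := Finset.sum_nonneg fun i _ => Real.rpow_nonneg (hx i) _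
  have hδ : 0 ≤ (∑ i, (x i + z i) ^ r) - ∑ i, x i ^ r := sub_nonneg.2 <|
    Finset.sum_le_sum fun i _ => Real.rpow_le_rpow (hx i) (le_add_of_nonneg_right (hz i)) hr0
  have h₁ := rpow_increment_mono hs hS0 hS hδ
  have h₂ : ((∑ i, y i ^ r) + ((∑ i, (x i + z i) ^ r) - ∑ i, x i ^ r)) ^ s ≤
      (∑ i, (y i + z i) ^ r) ^ s :=
    Real.rpow_le_rpow (by linarith) (by linarith) (by linarith)
  rw [add_sub_cancel] at h₁
  linarith

lemma add_one_rpow_le {q x : ℝ} (hq : 1 ≤ q) (hx : 0 ≤ x) :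
    (x + 1) ^ q ≤ 3 / 2 * (x ^ q + (3 * q) ^ q) := by
  set M := max x (3 * q) with hM
  have hMq : 3 * q ≤ M := le_max_right _ _
  have hM0 : 0 < M := by linarith
  have hexp : Real.exp (1 / 3) ≤ 3 / 2 := by
    refine le_of_pow_le_pow_left₀ (n := 3) (by norm_num) (by norm_num) ?_
    rw [← Real.exp_nat_mul]
    norm_num
    linarith [Real.exp_one_lt_d9]
  have hfac : (1 + 1 / M) ^ q ≤ 3 / 2 := by
    calc (1 + 1 / M) ^ q ≤ Real.exp (1 / M) ^ q :=
          Real.rpow_le_rpow (by positivity) (by linarith [Real.add_one_le_exp (1 / M)])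
            (by linarith)
      _ = Real.exp (1 / M * q) := (Real.exp_mul _ _).symm
      _ ≤ Real.exp (1 / 3) := by
          rw [Real.exp_le_exp, div_mul_eq_mul_div, div_le_div_iff₀ hM0 (by norm_num)]
          linarith
      _ ≤ 3 / 2 := hexp
  have hMle : M ^ q ≤ x ^ q + (3 * q) ^ q := by
    have h₁ : 0 ≤ x ^ q := by positivity
    have h₂ : 0 ≤ (3 * q) ^ q := by positivity
    rcases max_choice x (3 * q) with h | h <;> rw [hM, h] <;> linarith
  calc (x + 1) ^ q ≤ (M + 1) ^ q :=
        Real.rpow_le_rpow (by linarith) (by linarith [le_max_left x (3 * q)]) (by linarith)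
    _ = (1 + 1 / M) ^ q * M ^ q := by
        rw [← Real.mul_rpow (by positivity) hM0.le]
        congr 1
        field_simp
    _ ≤ 3 / 2 * (x ^ q + (3 * q) ^ q) := by gcongr

/-- The load matrix of a job `p` placed on machine `a`. -/
def jobLoad {m d : ℕ} (p : Fin m → Fin d → NNReal) (a : Fin m) : Fin m → Fin d → NNReal :=
  fun i k => if a = i then p i k else 0

lemma uLoad_append_singleton {m d : ℕ} (σ : List (Fin m → Fin d → NNReal))
    (p : Fin m → Fin d → NNReal) (f : Fin (σ ++ [p]).length → Fin m) :
    uLoad (σ ++ [p]) f =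
      uLoad σ (fun j => f ⟨j, by simp⟩) + jobLoad p (f ⟨σ.length, by simp⟩) := by
  have hlen : (σ ++ [p]).length = σ.length + 1 := by simp
  funext i k
  simp only [uLoad, jobLoad, Pi.add_apply]
  rw [← (finCongr hlen).symm.sum_comp, Fin.sum_univ_castSucc]
  congr 1
  · refine Finset.sum_congr rfl fun j _ => ?_
    simp [finCongr, Fin.cast, List.getElem_append_left]
  · simp [finCongr, Fin.cast, Fin.last]

lemma uLoad_uOnline_append_singleton {m d : ℕ} (A : List (Fin m → Fin d → NNReal) → Fin m)
    (σ : List (Fin m → Fin d → NNReal)) (p : Fin m → Fin d → NNReal) :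
    uLoad (σ ++ [p]) (uOnline A (σ ++ [p])) =
      uLoad σ (uOnline A σ) + jobLoad p (A (σ ++ [p])) := by
  rw [uLoad_append_singleton]
  congr 2
  · funext j
    simp only [uOnline]
    rw [List.take_append_of_le_length (by omega)]
  · simp only [uOnline]
    rw [List.take_of_length_le (by simp)]

/-- Greedy assignment with respect to a potential with increasing increments: the final potential
gain is at most the gain from adding the loads of any other assignment on top. -/
lemma exists_greedy {m d : ℕ} [NeZero m] (F : (Fin m → Fin d → NNReal) → ℝ)
    (hF : ∀ x y z, x ≤ y → F (x + z) - F x ≤ F (y + z) - F y) :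
    ∃ A : List (Fin m → Fin d → NNReal) → Fin m, ∀ σ f,
      F (uLoad σ (uOnline A σ)) - F 0 ≤
        F (uLoad σ (uOnline A σ) + uLoad σ f) - F (uLoad σ (uOnline A σ)) := by
  choose best hbest using fun (x p : Fin m → Fin d → NNReal) =>
    Finite.exists_min fun a => F (x + jobLoad p a)
  let state : List (Fin m → Fin d → NNReal) → Fin m → Fin d → NNReal :=
    List.foldl (fun x p => x + jobLoad p (best x p)) 0
  let A : List (Fin m → Fin d → NNReal) → Fin m :=
    fun σ => best (state σ.dropLast) (σ.getLastD 0)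
  have hstep : ∀ σ p, state (σ ++ [p]) = state σ + jobLoad p (best (state σ) p) := by
    intro σ p
    simp [state]
  have hstate : ∀ σ, uLoad σ (uOnline A σ) = state σ := by
    intro σ
    induction σ using List.reverseRecOn with
    | nil => funext i k; simp [uLoad, state]
    | append_singleton σ p ih =>
      rw [uLoad_uOnline_append_singleton, ih, hstep]
      simp [A]
  have key : ∀ σ f y, state σ ≤ y → F (state σ) - F 0 ≤ F (y + uLoad σ f) - F y := by
    intro σ
    induction σ using List.reverseRecOn with
    | nil =>
      intro f y _
      have h0 : uLoad [] f = 0 := by funext i k; simp [uLoad]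
      simp [h0, state]
    | append_singleton σ p ih =>
      intro f y hy
      rw [hstep] at hy ⊢
      have hy' : state σ ≤ y := le_trans le_self_add hy
      rw [uLoad_append_singleton, ← add_assoc]
      have h₁ := ih (fun j => f ⟨j, by simp⟩) y hy'
      have h₂ := hbest (state σ) p (f ⟨σ.length, by simp⟩)
      have h₃ := hF (state σ) (y + uLoad σ fun j => f ⟨j, by simp⟩)
        (jobLoad p (f ⟨σ.length, by simp⟩)) (le_trans hy' le_self_add)
      linarith
  refine ⟨A, fun σ f => ?_⟩
  rw [hstate]
  exact key σ f _ le_rfl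

/-- Any-norm upper bound for vector scheduling on unrelated machines (VSANY-U):
there is `c > 0` such that for every `m ≥ 2`, `d ≥ 1` and norms
`1 ≤ r k ≤ log m` (one per dimension) there is a deterministic online algorithm
such that on every job sequence admitting an offline assignment with
`L_{r k}` norm at most `1` in each dimension `k`, the algorithm's `L_{r k}`
norm in dimension `k` is at most `c · (r k + log d)` for every `k`. -/
theorem vsanyU_upperBound :
    ∃ c : ℝ, 0 < c ∧ ∀ m d : ℕ, 2 ≤ m → 1 ≤ d →
      ∀ r : Fin d → ℝ, (∀ k, 1 ≤ r k ∧ r k ≤ Real.log m) →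
        ∃ A : List (Fin m → Fin d → NNReal) → Fin m,
          ∀ σ : List (Fin m → Fin d → NNReal),
            (∃ g : Fin σ.length → Fin m, ∀ k, uNorm σ g k (r k) ≤ 1) →
              ∀ k, uNorm σ (uOnline A σ) k (r k) ≤ c * (r k + Real.log d) := by
  refine ⟨9 * Real.exp 1, by positivity, fun m d hm hd r hr => ?_⟩
  have : NeZero m := ⟨by omega⟩
  have hlogd : 0 ≤ Real.log d := Real.log_natCast_nonneg d
  have hd0 : (0 : ℝ) < d := by exact_mod_cast hd
  set q : Fin d → ℝ := fun k => r k + Real.log d with hqdef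
  have hqr : ∀ k, r k ≤ q k := fun k => by simp [hqdef, hlogd]
  have hq1 : ∀ k, 1 ≤ q k := fun k => (hr k).1.trans (hqr k)
  have hr0 : ∀ k, 0 < r k := fun k => by linarith [(hr k).1]
  have hq0 : ∀ k, 0 < q k := fun k => by linarith [hq1 k]
  have hqd : ∀ k, Real.log d ≤ q k := fun k => by simp [hqdef, (hr0 k).le]
  let N : (Fin m → Fin d → NNReal) → Fin d → ℝ :=
    fun x k => (∑ i, (x i k : ℝ) ^ r k) ^ (1 / r k)
  have hsum0 : ∀ x k, 0 ≤ ∑ i, ((x : Fin m → Fin d → NNReal) i k : ℝ) ^ r k := fun x k =>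
    Finset.sum_nonneg fun i _ => Real.rpow_nonneg (NNReal.coe_nonneg _) _
  have hN0 : ∀ x k, 0 ≤ N x k := fun x k => Real.rpow_nonneg (hsum0 x k) _
  have hNpow : ∀ x k, N x k ^ q k = (∑ i, (x i k : ℝ) ^ r k) ^ (q k / r k) := fun x k => by
    rw [← Real.rpow_mul (hsum0 x k)]
    congr 1
    ring
  have hNadd : ∀ x y k, N (x + y) k ≤ N x k + N y k := fun x y k => by
    simpa [N] using Real.Lp_add_le_of_nonneg (s := Finset.univ) (hr k).1
      (f := fun i => (x i k : ℝ)) (g := fun i => (y i k : ℝ)) (by simp) (by simp)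
  let F : (Fin m → Fin d → NNReal) → ℝ := fun x => ∑ k, N x k ^ q k / (3 * q k) ^ q k
  have hα : ∀ k, 0 < (3 * q k) ^ q k := fun k =>
    Real.rpow_pos_of_pos (by linarith [hq0 k]) _
  have hF : ∀ x y z, x ≤ y → F (x + z) - F x ≤ F (y + z) - F y := by
    intro x y z hxy
    simp only [F, ← Finset.sum_sub_distrib, ← sub_div]
    refine Finset.sum_le_sum fun k _ => div_le_div_of_nonneg_right ?_ (hα k).le
    simp only [hNpow]
    simpa using sum_rpow_rpow_increment_mono (hr k).1 ((one_le_div (hr0 k)).2 (hqr k))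
      (x := fun i => (x i k : ℝ)) (y := fun i => (y i k : ℝ)) (z := fun i => (z i k : ℝ))
      (fun i => NNReal.coe_nonneg _) (fun i => NNReal.coe_le_coe.2 (hxy i k))
      (fun i => NNReal.coe_nonneg _)
  have hFzero : F 0 = 0 := by
    refine Finset.sum_eq_zero fun k _ => ?_
    have : N 0 k = 0 := by
      simp [N, Real.zero_rpow (hr0 k).ne', (hr0 k).ne']
    rw [this, Real.zero_rpow (hq0 k).ne', zero_div]
  obtain ⟨A, hA⟩ := exists_greedy F hF
  refine ⟨A, fun σ ⟨g, hg⟩ k => ?_⟩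
  have hgreedy := hA σ g
  set L := uLoad σ (uOnline A σ) with hL
  have hadd : F (L + uLoad σ g) ≤ 3 / 2 * F L + 3 / 2 * d := by
    have hterm : ∀ k, N (L + uLoad σ g) k ^ q k / (3 * q k) ^ q k ≤
        3 / 2 * (N L k ^ q k / (3 * q k) ^ q k) + 3 / 2 := by
      intro k
      have h₁ : N (L + uLoad σ g) k ≤ N L k + 1 := (hNadd _ _ k).trans (by gcongr; exact hg k)
      have h₂ := (Real.rpow_le_rpow (hN0 _ k) h₁ (hq0 k).le).trans
        (add_one_rpow_le (hq1 k) (hN0 L k))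
      rw [div_le_iff₀ (hα k), add_mul, mul_assoc, div_mul_cancel₀ _ (hα k).ne']
      linarith
    refine (Finset.sum_le_sum fun k _ => hterm k).trans_eq ?_
    rw [Finset.sum_add_distrib, ← Finset.mul_sum]
    simp [F, mul_comm]
  have hFL : F L ≤ 3 * d := by linarith
  have hkF : N L k ^ q k / (3 * q k) ^ q k ≤ F L :=
    Finset.single_le_sum
      (f := fun k => N L k ^ q k / (3 * q k) ^ q k)
      (fun k _ => div_nonneg (Real.rpow_nonneg (hN0 L k) _) (hα k).le) (Finset.mem_univ k)
  have h3q : 0 < 3 * q k := by linarith [hq0 k]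
  have hdpow : 3 * (d : ℝ) ≤ (3 * Real.exp 1) ^ q k := by
    rw [Real.mul_rpow (by norm_num) (Real.exp_pos 1).le, ← Real.exp_mul, one_mul]
    have h₁ : (3 : ℝ) ≤ 3 ^ q k := by
      simpa using Real.rpow_le_rpow_of_exponent_le (by norm_num : (1 : ℝ) ≤ 3) (hq1 k)
    have h₂ : (d : ℝ) ≤ Real.exp (q k) := (Real.log_le_iff_le_exp hd0).1 (hqd k)
    gcongr
  have hratio : (N L k / (3 * q k)) ^ q k ≤ (3 * Real.exp 1) ^ q k := by
    rw [Real.div_rpow (hN0 L k) h3q.le]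
    linarith
  rw [Real.rpow_le_rpow_iff (div_nonneg (hN0 L k) h3q.le) (by positivity) (hq0 k),
    div_le_iff₀ h3q] at hratio
  calc N L k ≤ 3 * Real.exp 1 * (3 * q k) := hratio
    _ = 9 * Real.exp 1 * (r k + Real.log d) := by rw [hqdef]; ring
end

section
/- There exist constants c > 0 and C ≥ 1 such that for every integer t ≥ 1 and every deterministic online coloring algorithm A using t colors, there exist an integer n and a graph G on vertex set {0, 1, …, n−1} such that the coloring of G produced by A (processing the vertices in increasing order) contains a monochromatic clique of size at least c·√t, while there exists an (offline) coloring χ : {0,…,n−1} → {1,…,t} of the same graph G in which every monochromatic clique has size at most C. -/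
/-- The color that the deterministic online coloring algorithm `A` (using `t`
colors) gives to vertex `v` of the graph `G` when the vertices `0, 1, …, n-1`
arrive in increasing order: the color of vertex `v` depends only on the
subgraph of `G` induced on the vertices `{0, …, v}`. -/
def onlineColor {t : ℕ} (A : (j : ℕ) → SimpleGraph (Fin (j + 1)) → Fin t)
    {n : ℕ} (G : SimpleGraph (Fin n)) (v : Fin n) : Fin t :=
  A v.1 (G.comap (Fin.castLE v.isLt))

/-- The graph in which vertex `v` is joined to exactly those earlier vertices whose color under `χ`
is not in the set `P v` of colors admissible for `v`. -/
def admissibleGraph {α : Type*} (χ : ℕ → α) (P : ℕ → Set α) : SimpleGraph ℕ :=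
  SimpleGraph.fromRel fun u v => u < v ∧ χ u ∉ P v

theorem admissibleGraph_adj_of_lt {α : Type*} {χ : ℕ → α} {P : ℕ → Set α} {u v : ℕ} (h : u < v) :
    (admissibleGraph χ P).Adj u v ↔ χ u ∉ P v := by
  simp [admissibleGraph, h, h.ne, h.not_gt]

/-- The color given to vertex `j` of `G` by the online algorithm `A`. -/
def natOnlineColor {t : ℕ} (A : (j : ℕ) → SimpleGraph (Fin (j + 1)) → Fin t)
    (G : SimpleGraph ℕ) (j : ℕ) : Fin t :=
  A j (G.comap Fin.val)

theorem natOnlineColor_congr {t : ℕ} (A : (j : ℕ) → SimpleGraph (Fin (j + 1)) → Fin t)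
    {χ χ' : ℕ → Fin t} {P P' : ℕ → Set (Fin t)} {j : ℕ} (hχ : ∀ u < j, χ u = χ' u)
    (hP : ∀ u ≤ j, P u = P' u) :
    natOnlineColor A (admissibleGraph χ P) j = natOnlineColor A (admissibleGraph χ' P') j := by
  have key : ∀ u v : Fin (j + 1), u.1 < v.1 →
      ((admissibleGraph χ P).Adj u v ↔ (admissibleGraph χ' P').Adj u v) := fun u v h => by
    rw [admissibleGraph_adj_of_lt h, admissibleGraph_adj_of_lt h, hχ u (by omega),
      hP v (by omega)]
  unfold natOnlineColor
  congr 1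
  ext u v
  simp only [SimpleGraph.comap_adj]
  rcases lt_trichotomy u.1 v.1 with h | h | h
  · exact key u v h
  · simp [h]
  · rw [SimpleGraph.adj_comm, key v u h, SimpleGraph.adj_comm]

theorem onlineColor_comap_val {t : ℕ} (A : (j : ℕ) → SimpleGraph (Fin (j + 1)) → Fin t)
    (G : SimpleGraph ℕ) {n : ℕ} (v : Fin n) :
    onlineColor A (G.comap Fin.val) v = natOnlineColor A G v :=
  rfl

/-- State of the adversary after `n` rounds, relative to the online coloring `κ`: `χ` is a proper
offline coloring, injective on each online color class, and `f` splits each online color class into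
two cliques. -/
structure AdversaryState {α : Type*} (κ χ : ℕ → α) (P : ℕ → Set α) (f : ℕ → Bool) (n : ℕ) :
    Prop where
  admissible : ∀ v < n, χ v ∈ P v
  injective : ∀ u v, u < v → v < n → κ u = κ v → χ u ≠ χ v
  clique : ∀ u v, u < v → v < n → κ u = κ v → f u = f v → χ u ∉ P v

/-- Sets of size less than `√t` indexed by `Fin t` cannot cover all pairs of elements of `Fin t`. -/
theorem exists_uncovered_pair {t : ℕ} (ht : 1 ≤ t) (S : Fin t → Finset (Fin t))
    (hS : ∀ b, (S b).card * (S b).card < t) :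
    ∃ x y, ∀ b, x ∉ S b ∨ y ∉ S b := by
  by_contra! h
  have hsub : (Finset.univ : Finset (Fin t × Fin t)) ⊆
      Finset.univ.biUnion fun b => S b ×ˢ S b := fun p _ => by
    obtain ⟨b, hb⟩ := h p.1 p.2
    simpa using ⟨b, hb⟩
  have h1 := (Finset.card_le_card hsub).trans Finset.card_biUnion_le
  have h2 : ∑ b, (S b ×ˢ S b).card < ∑ _b : Fin t, t :=
    Finset.sum_lt_sum_of_nonempty ⟨⟨0, ht⟩, Finset.mem_univ _⟩ fun b _ => by
      simpa using hS b
  simp at h1 h2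
  omega

/-- One round of the adversary's strategy. -/
theorem AdversaryState.exists_succ {t n : ℕ} (ht : 1 ≤ t)
    (A : (j : ℕ) → SimpleGraph (Fin (j + 1)) → Fin t) {χ : ℕ → Fin t} {P : ℕ → Set (Fin t)}
    {f : ℕ → Bool} (h : AdversaryState (natOnlineColor A (admissibleGraph χ P)) χ P f n)
    (hsmall : ∀ b, ((Finset.range n).filter
        fun v => natOnlineColor A (admissibleGraph χ P) v = b).card ^ 2 < t) :
    ∃ χ' P' f', AdversaryState (natOnlineColor A (admissibleGraph χ' P')) χ' P' f' (n + 1) := by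
  set κ := natOnlineColor A (admissibleGraph χ P) with hκ
  obtain ⟨c, d, hcd⟩ := exists_uncovered_pair ht
    (fun b => ((Finset.range n).filter fun v => κ v = b).image χ) fun b =>
      (Nat.mul_le_mul Finset.card_image_le Finset.card_image_le).trans_lt
        (by simpa [sq] using hsmall b)
  set P' := Function.update P n {c, d} with hP'
  set b := natOnlineColor A (admissibleGraph χ P') n with hb
  obtain ⟨x, y, hxy, hx⟩ : ∃ x y, ({c, d} : Set (Fin t)) = {x, y} ∧
      ∀ u < n, κ u = b → χ u ≠ x := by
    rcases hcd b with hc | hd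
    · exact ⟨c, d, rfl, fun u hu hub hux => hc (by simpa using ⟨u, ⟨hu, hub⟩, hux⟩)⟩
    · exact ⟨d, c, Set.pair_comm c d, fun u hu hub hux => hd (by simpa using ⟨u, ⟨hu, hub⟩, hux⟩)⟩
  obtain ⟨g, hg⟩ : ∃ g : Bool, ∀ u < n, κ u = b → χ u = y → f u ≠ g := by
    by_cases hy : ∃ u < n, κ u = b ∧ χ u = y
    · obtain ⟨u, hu, hub, huy⟩ := hy
      refine ⟨!f u, fun v hv hvb hvy => ?_⟩
      have : v = u := by
        rcases lt_trichotomy u v with huv | huv | huv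
        · exact absurd (huy.trans hvy.symm) (h.injective u v huv hv (hub.trans hvb.symm))
        · exact huv.symm
        · exact absurd (hvy.trans huy.symm) (h.injective v u huv hu (hvb.trans hub.symm))
      simp [this]
    · push Not at hy
      exact ⟨true, fun u hu hub huy => absurd huy (hy u hu hub)⟩
  set χ' := Function.update χ n x with hχ'
  have hχlt : ∀ u < n, χ' u = χ u := fun u hu => by simp [hχ', hu.ne]
  have hPlt : ∀ u < n, P' u = P u := fun u hu => by simp [hP', hu.ne]
  have hχn : χ' n = x := by simp [hχ']
  have hPn : P' n = {x, y} := by simp [hP', hxy]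
  have hκlt : ∀ u < n, natOnlineColor A (admissibleGraph χ' P') u = κ u := fun u hu =>
    natOnlineColor_congr A (fun v hv => hχlt v (hv.trans hu)) fun v hv => hPlt v (hv.trans_lt hu)
  have hκn : natOnlineColor A (admissibleGraph χ' P') n = b :=
    natOnlineColor_congr A hχlt fun _ _ => rfl
  refine ⟨χ', P', Function.update f n g, ⟨fun v hv => ?_, fun u v huv hv he => ?_,
    fun u v huv hv he hf => ?_⟩⟩
  · rcases Nat.lt_succ_iff_lt_or_eq.mp hv with hv | rfl
    · rw [hχlt v hv, hPlt v hv]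
      exact h.admissible v hv
    · simp [hχn, hPn]
  · rcases Nat.lt_succ_iff_lt_or_eq.mp hv with hv | rfl
    · rw [hκlt u (huv.trans hv), hκlt v hv] at he
      rw [hχlt u (huv.trans hv), hχlt v hv]
      exact h.injective u v huv hv he
    · rw [hκlt u huv, hκn] at he
      rw [hχlt u huv, hχn]
      exact hx u huv he
  · rcases Nat.lt_succ_iff_lt_or_eq.mp hv with hv | rfl
    · rw [hκlt u (huv.trans hv), hκlt v hv] at he
      rw [Function.update_of_ne (huv.trans hv).ne, Function.update_of_ne hv.ne] at hf
      rw [hχlt u (huv.trans hv), hPlt v hv]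
      exact h.clique u v huv hv he hf
    · rw [hκlt u huv, hκn] at he
      rw [Function.update_of_ne huv.ne, Function.update_self] at hf
      rw [hχlt u huv, hPn]
      rintro (hux | huy)
      · exact hx u huv he hux
      · exact hg u huv he huy hf

/-- The offline coloring maintained by the adversary is proper. -/
theorem AdversaryState.ne_of_adj {α : Type*} {κ χ : ℕ → α} {P : ℕ → Set α} {f : ℕ → Bool} {n : ℕ}
    (h : AdversaryState κ χ P f n) {u v : ℕ} (hu : u < n) (hv : v < n)
    (hadj : (admissibleGraph χ P).Adj u v) : χ u ≠ χ v := by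
  intro he
  rcases lt_or_gt_of_ne hadj.ne with huv | huv
  · exact (admissibleGraph_adj_of_lt huv).mp hadj (he ▸ h.admissible v hv)
  · exact (admissibleGraph_adj_of_lt huv).mp hadj.symm (he ▸ h.admissible u hu)

/-- The vertices of one online color on one side of the splitting `f` are pairwise adjacent. -/
theorem AdversaryState.adj {α : Type*} {κ χ : ℕ → α} {P : ℕ → Set α} {f : ℕ → Bool} {n : ℕ}
    (h : AdversaryState κ χ P f n) {u v : ℕ} (hu : u < n) (hv : v < n) (hne : u ≠ v)
    (hκ : κ u = κ v) (hf : f u = f v) : (admissibleGraph χ P).Adj u v := by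
  rcases lt_or_gt_of_ne hne with huv | huv
  · exact (admissibleGraph_adj_of_lt huv).mpr (h.clique u v huv hv hκ hf)
  · exact ((admissibleGraph_adj_of_lt huv).mpr (h.clique v u huv hu hκ.symm hf.symm)).symm

/-- The number of rounds is bounded, as online and offline color together identify a vertex. -/
theorem AdversaryState.le_sq {t n : ℕ} {κ χ : ℕ → Fin t} {P : ℕ → Set (Fin t)} {f : ℕ → Bool}
    (h : AdversaryState κ χ P f n) : n ≤ t * t := by
  have hinj : Function.Injective fun v : Fin n => (κ v, χ v) := by
    intro u v huv
    simp only [Prod.mk.injEq] at huv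
    rcases lt_trichotomy u v with hlt | heq | hlt
    · exact absurd huv.2 (h.injective u v hlt v.2 huv.1)
    · exact heq
    · exact absurd huv.2.symm (h.injective v u hlt u.2 huv.1.symm)
  simpa using Fintype.card_le_of_injective _ hinj

/-- The adversary can play until some online color class has at least `√t` vertices. -/
theorem exists_adversaryState_large {t : ℕ} (ht : 1 ≤ t)
    (A : (j : ℕ) → SimpleGraph (Fin (j + 1)) → Fin t) :
    ∃ n χ P f, AdversaryState (natOnlineColor A (admissibleGraph χ P)) χ P f n ∧
      ∃ b, t ≤ ((Finset.range n).filter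
        fun v => natOnlineColor A (admissibleGraph χ P) v = b).card ^ 2 := by
  by_contra! hsmall
  have hall : ∀ n, ∃ χ P f,
      AdversaryState (natOnlineColor A (admissibleGraph χ P)) χ P f n := fun n => by
    induction n with
    | zero =>
      exact ⟨fun _ => ⟨0, ht⟩, fun _ => ∅, fun _ => true, ⟨by simp, by simp, by simp⟩⟩
    | succ n ih =>
      obtain ⟨χ, P, f, h⟩ := ih
      exact h.exists_succ ht A (hsmall n χ P f h)
  obtain ⟨χ, P, f, h⟩ := hall (t * t + 1)
  exact absurd h.le_sq (by omega)

/-- Lower bound of `Ω(√t)` for online minimization of the largest monochromatic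
clique with `t` colors: there are constants `c > 0` and `C ≥ 1` such that for
every `t ≥ 1` and every deterministic online coloring algorithm `A` with `t`
colors, there is a graph `G` on vertices `{0, …, n-1}` (presented in increasing
order) on which `A` creates a monochromatic clique of size at least `c·√t`,
while some offline `t`-coloring of `G` has all monochromatic cliques of size at
most `C`. -/
theorem online_monochromatic_clique_lowerBound :
    ∃ c : ℝ, 0 < c ∧ ∃ C : ℕ, 1 ≤ C ∧
      ∀ t : ℕ, 1 ≤ t →
        ∀ A : (j : ℕ) → SimpleGraph (Fin (j + 1)) → Fin t,
          ∃ n : ℕ, ∃ G : SimpleGraph (Fin n),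
            (∃ S : Finset (Fin n), G.IsClique ↑S ∧
              (∃ col : Fin t, ∀ v ∈ S, onlineColor A G v = col) ∧
              c * Real.sqrt t ≤ (S.card : ℝ)) ∧
            (∃ χ : Fin n → Fin t, ∀ S : Finset (Fin n), G.IsClique ↑S →
              (∃ col : Fin t, ∀ v ∈ S, χ v = col) → S.card ≤ C) := by
  refine ⟨1 / 2, by norm_num, 1, le_rfl, fun t ht A => ?_⟩
  obtain ⟨n, χ, P, f, h, b, hb⟩ := exists_adversaryState_large ht A
  set κ := natOnlineColor A (admissibleGraph χ P) with hκ
  let T : Finset (Fin n) := Finset.univ.filter fun v => κ v = b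
  have hT : T.card = ((Finset.range n).filter fun v => κ v = b).card := by
    rw [Finset.card_filter, Finset.card_filter, Finset.sum_range]
  have hsqrt : Real.sqrt t ≤ T.card := by
    rw [← hT] at hb
    exact Real.sqrt_le_iff.mpr ⟨by positivity, by exact_mod_cast hb⟩
  obtain ⟨g, hg⟩ : ∃ g, T.card ≤ 2 * (T.filter fun v : Fin n => f v = g).card := by
    have hsplit := T.card_filter_add_card_filter_not (fun v : Fin n => f v = true)
    simp only [Bool.not_eq_true] at hsplit
    rcases le_total (T.filter fun v : Fin n => f v = false).card (T.filter fun v : Fin n => f v = true).card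
      with hle | hle
    · exact ⟨true, by omega⟩
    · exact ⟨false, by omega⟩
  refine ⟨n, (admissibleGraph χ P).comap Fin.val, ⟨T.filter fun v : Fin n => f v = g, ?_, ⟨b, ?_⟩, ?_⟩,
    fun v => χ v, ?_⟩
  · intro u hu v hv hne
    simp only [T, Finset.coe_filter, Finset.mem_filter, Finset.mem_univ, true_and,
      Set.mem_ofPred_eq] at hu hv
    exact h.adj u.2 v.2 (Fin.val_ne_of_ne hne) (hu.1.trans hv.1.symm) (hu.2.trans hv.2.symm)
  · intro v hv
    rw [onlineColor_comap_val]
    simp only [T, Finset.mem_filter, Finset.mem_univ, true_and] at hv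
    exact hv.1
  · have : (T.card : ℝ) ≤ 2 * (T.filter fun v : Fin n => f v = g).card := by exact_mod_cast hg
    linarith
  · rintro S hS ⟨col, hcol⟩
    refine Finset.card_le_one.mpr fun u hu v hv => ?_
    by_contra hne
    exact h.ne_of_adj u.2 v.2 (hS hu hv hne) ((hcol u hu).trans (hcol v hv).symm)
end
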